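/- arXiv:1110.5894 — 7 statements merged into one kernel-verified Lean document; each statement's English description precedes it below -/
import Mathlib

section
/- Let Ψ : (0,∞) → [0,∞) be strictly increasing with ∫₀^∞ 1/(1+Ψ(ζ)) dζ < ∞. Then for every ξ > 0 and every z ∈ ℂ with Im z > 0, one has Im φ(z) < 0 (in particular φ(z) ≠ 0) and Im(φ(ξ,z)/φ(z)) ≤ 0. -/
open MeasureTheory Filter Topology Set

/-- `φ(z) = (1/π) ∫₀^∞ 1/(Ψ(ζ)+z) dζ`. -/
noncomputable def phi (Ψ : ℝ → ℝ) (z : ℂ) : ℂ :=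
  (Real.pi : ℂ)⁻¹ * ∫ ζ in Ioi (0:ℝ), ((Ψ ζ : ℂ) + z)⁻¹

/-- `φ(ξ,z) = (1/π) ∫₀^∞ (ξ²/(ξ²+ζ²)) / (Ψ(ζ)+z) dζ`. -/
noncomputable def phi1 (Ψ : ℝ → ℝ) (ξ : ℝ) (z : ℂ) : ℂ :=
  (Real.pi : ℂ)⁻¹ * ∫ ζ in Ioi (0:ℝ), ((ξ^2 / (ξ^2 + ζ^2) : ℝ) : ℂ) * ((Ψ ζ : ℂ) + z)⁻¹

theorem ofReal_add_ne_zero (r : ℝ) {z : ℂ} (hz : 0 < z.im) : (r : ℂ) + z ≠ 0 := fun h => by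
  have him : z.im = 0 := by simpa using congrArg Complex.im h
  exact hz.ne' him

theorem integrableOn_inv_ofReal_add {Ψ : ℝ → ℝ} (hmono : StrictMonoOn Ψ (Ioi 0))
    (hnonneg : ∀ ζ ∈ Ioi (0:ℝ), 0 ≤ Ψ ζ)
    (hint : IntegrableOn (fun ζ => 1 / (1 + Ψ ζ)) (Ioi 0)) {z : ℂ} (hz : 0 < z.im) :
    IntegrableOn (fun ζ => ((Ψ ζ : ℂ) + z)⁻¹) (Ioi 0) := by
  have hmeas : AEMeasurable Ψ (volume.restrict (Ioi 0)) :=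
    aemeasurable_restrict_of_monotoneOn measurableSet_Ioi hmono.monotoneOn
  refine (hint.const_mul (1 + (1 + ‖z‖) / z.im)).mono'
    ((Complex.measurable_ofReal.comp_aemeasurable hmeas).add_const z).inv.aestronglyMeasurable ?_
  refine (ae_restrict_iff' measurableSet_Ioi).2 (Eventually.of_forall fun ζ hζ => ?_)
  have hΨ := hnonneg ζ hζ
  have h₁ : z.im ≤ ‖(Ψ ζ : ℂ) + z‖ := by
    simpa using (le_abs_self _).trans (Complex.abs_im_le_norm ((Ψ ζ : ℂ) + z))
  have h₂ : Ψ ζ ≤ ‖(Ψ ζ : ℂ) + z‖ + ‖z‖ := by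
    have h := norm_sub_le ((Ψ ζ : ℂ) + z) z
    rwa [add_sub_cancel_right, Complex.norm_real, Real.norm_of_nonneg hΨ] at h
  have hpos : 0 < ‖(Ψ ζ : ℂ) + z‖ := hz.trans_le h₁
  have h₃ : 1 + ‖z‖ ≤ (1 + ‖z‖) / z.im * ‖(Ψ ζ : ℂ) + z‖ := by
    rw [div_mul_eq_mul_div, le_div_iff₀ hz]
    gcongr
  rw [norm_inv, mul_one_div, inv_eq_one_div, div_le_div_iff₀ hpos (by linarith)]
  linarith

theorem integral_inv_ofReal_add_im_neg {Ψ : ℝ → ℝ} {z : ℂ} (hz : 0 < z.im)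
    (hg : IntegrableOn (fun ζ => ((Ψ ζ : ℂ) + z)⁻¹) (Ioi 0)) :
    (∫ ζ in Ioi (0:ℝ), ((Ψ ζ : ℂ) + z)⁻¹).im < 0 := by
  have hpos : ∀ ζ, 0 < -(((Ψ ζ : ℂ) + z)⁻¹).im := fun ζ => by
    have := Complex.normSq_pos.2 (ofReal_add_ne_zero (Ψ ζ) hz)
    rw [Complex.inv_im]
    simp only [Complex.add_im, Complex.ofReal_im, zero_add, neg_div, neg_neg]
    positivity
  have him : ∫ ζ in Ioi (0:ℝ), (((Ψ ζ : ℂ) + z)⁻¹).im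
      = (∫ ζ in Ioi (0:ℝ), ((Ψ ζ : ℂ) + z)⁻¹).im := integral_im hg
  have h : 0 < ∫ ζ in Ioi (0:ℝ), -(((Ψ ζ : ℂ) + z)⁻¹).im := by
    rw [integral_pos_iff_support_of_nonneg (fun ζ => (hpos ζ).le) hg.im.neg]
    have : (Function.support fun ζ => -(((Ψ ζ : ℂ) + z)⁻¹).im) = univ :=
      eq_univ_of_forall fun ζ => (hpos ζ).ne'
    rw [this]
    simp
  rw [integral_neg, him] at h
  linarith

/-- If `w ≥ 0` is bounded and `w` is no larger where `h > 0` than where `h ≤ 0`, then `∫ h = 0`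
forces `∫ w h ≤ 0`. -/
theorem setIntegral_mul_nonpos_of_integral_eq_zero {α : Type*} [MeasurableSpace α]
    {μ : Measure α} {s : Set α} (hs : MeasurableSet s) {w h : α → ℝ} {C : ℝ}
    (hw : ∀ x, 0 ≤ w x) (hwC : ∀ x, w x ≤ C)
    (hwh : ∀ x ∈ s, ∀ y ∈ s, 0 < h x → h y ≤ 0 → w x ≤ w y)
    (hi : IntegrableOn h s μ) (hwi : IntegrableOn (fun x => w x * h x) s μ)
    (h0 : ∫ x in s, h x ∂μ = 0) : ∫ x in s, w x * h x ∂μ ≤ 0 := by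
  set k := sSup (w '' {x | x ∈ s ∧ 0 < h x})
  have hk : ∫ x in s, (w x * h x - k * h x) ∂μ ≤ 0 := by
    refine setIntegral_nonpos hs fun x hx => ?_
    rw [← sub_mul]
    rcases lt_or_ge 0 (h x) with hpos | hneg
    · have : w x ≤ k := le_csSup ⟨C, by rintro _ ⟨y, -, rfl⟩; exact hwC y⟩ ⟨x, ⟨hx, hpos⟩, rfl⟩
      exact mul_nonpos_of_nonpos_of_nonneg (by linarith) hpos.le
    · have : k ≤ w x := by
        refine Real.sSup_le ?_ (hw x)
        rintro _ ⟨y, ⟨hy, hypos⟩, rfl⟩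
        exact hwh y hy x hx hypos hneg
      exact mul_nonpos_of_nonneg_of_nonpos (by linarith) hneg
  rwa [integral_sub hwi (hi.const_mul k), integral_const_mul, h0, mul_zero, sub_zero] at hk

theorem inv_ofReal_add_mul_im (r : ℝ) (z c : ℂ) :
    (((r : ℂ) + z)⁻¹ * c).im
      = (r * c.im + (z.re * c.im - z.im * c.re)) / Complex.normSq ((r : ℂ) + z) := by
  simp only [Complex.mul_im, Complex.inv_re, Complex.inv_im, Complex.add_re, Complex.add_im,
    Complex.ofReal_re, Complex.ofReal_im]
  ring

theorem im_phi_neg_and_im_ratio_nonpos (Ψ : ℝ → ℝ)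
    (hmono : StrictMonoOn Ψ (Ioi 0))
    (hnonneg : ∀ ζ ∈ Ioi (0:ℝ), 0 ≤ Ψ ζ)
    (hint : IntegrableOn (fun ζ => 1 / (1 + Ψ ζ)) (Ioi 0))
    (ξ : ℝ) (hξ : 0 < ξ) (z : ℂ) (hz : 0 < z.im) :
    (phi Ψ z).im < 0 ∧ phi Ψ z ≠ 0 ∧ (phi1 Ψ ξ z / phi Ψ z).im ≤ 0 := by
  have hg := integrableOn_inv_ofReal_add hmono hnonneg hint hz
  have ha := integral_inv_ofReal_add_im_neg hz hg
  have hphi : (phi Ψ z).im < 0 := by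
    rw [phi, ← Complex.ofReal_inv, Complex.im_ofReal_mul]
    exact mul_neg_of_pos_of_neg (inv_pos.2 Real.pi_pos) ha
  refine ⟨hphi, fun h => by simp [h] at hphi, ?_⟩
  rw [phi1, phi, mul_div_mul_left _ _ (inv_ne_zero (Complex.ofReal_ne_zero.2 Real.pi_ne_zero))]
  set a := ∫ ζ in Ioi (0:ℝ), ((Ψ ζ : ℂ) + z)⁻¹ with ha_def
  set w : ℝ → ℝ := fun ζ => ξ ^ 2 / (ξ ^ 2 + ζ ^ 2) with hw_def
  have hden : ∀ ζ : ℝ, 0 < ξ ^ 2 + ζ ^ 2 := fun ζ => by positivity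
  have hw0 : ∀ ζ, 0 ≤ w ζ := fun ζ => by positivity
  have hw1 : ∀ ζ, w ζ ≤ 1 := fun ζ => (div_le_one (hden ζ)).2 (by nlinarith [sq_nonneg ζ])
  have hwc : Continuous w :=
    continuous_const.div (by fun_prop) fun ζ => (hden ζ).ne'
  have hwg : IntegrableOn (fun ζ => (w ζ : ℂ) * ((Ψ ζ : ℂ) + z)⁻¹) (Ioi 0) := by
    refine hg.bdd_mul (c := 1) (Complex.continuous_ofReal.comp hwc).aestronglyMeasurable
      (Eventually.of_forall fun ζ => ?_)
    simpa [abs_of_nonneg (hw0 ζ)] using hw1 ζ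
  set c := starRingEnd ℂ a with hc
  have hc_im : 0 < c.im := by simpa [hc] using ha
  have hmul : ∀ ζ, w ζ * (((Ψ ζ : ℂ) + z)⁻¹ * c).im
      = ((w ζ : ℂ) * ((Ψ ζ : ℂ) + z)⁻¹ * c).im := fun ζ => by
    rw [mul_assoc, Complex.im_ofReal_mul]
  have hgc : IntegrableOn (fun ζ => ((Ψ ζ : ℂ) + z)⁻¹ * c) (Ioi 0) := hg.mul_const c
  have hwgc : IntegrableOn (fun ζ => (w ζ : ℂ) * ((Ψ ζ : ℂ) + z)⁻¹ * c) (Ioi 0) :=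
    hwg.mul_const c
  have hgc_im : ∫ ζ in Ioi (0:ℝ), (((Ψ ζ : ℂ) + z)⁻¹ * c).im = 0 := by
    have h : ∫ ζ in Ioi (0:ℝ), (((Ψ ζ : ℂ) + z)⁻¹ * c).im
        = (∫ ζ in Ioi (0:ℝ), ((Ψ ζ : ℂ) + z)⁻¹ * c).im := integral_im hgc
    rw [h, integral_mul_const, ← ha_def, hc, Complex.mul_conj, Complex.ofReal_im]
  have hmain : ∫ ζ in Ioi (0:ℝ), w ζ * (((Ψ ζ : ℂ) + z)⁻¹ * c).im ≤ 0 := by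
    refine setIntegral_mul_nonpos_of_integral_eq_zero measurableSet_Ioi hw0 hw1 ?_ hgc.im ?_ hgc_im
    · intro x hx y hy hpos hneg
      rw [inv_ofReal_add_mul_im] at hpos hneg
      have hx' := (div_pos_iff_of_pos_right (Complex.normSq_pos.2 (ofReal_add_ne_zero (Ψ x) hz))).1 hpos
      have hy' : Ψ y * c.im + (z.re * c.im - z.im * c.re) ≤ 0 := by
        by_contra! h
        exact hneg.not_gt (div_pos h (Complex.normSq_pos.2 (ofReal_add_ne_zero (Ψ y) hz)))
      have hΨ : Ψ y < Ψ x := lt_of_mul_lt_mul_right (by linarith) hc_im.le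
      have hyx : y < x := (hmono.lt_iff_lt hy hx).1 hΨ
      have hy0 : 0 < y := hy
      simp only [hw_def]
      gcongr
    · simp only [hmul]
      exact hwgc.im
  have hb : ∫ ζ in Ioi (0:ℝ), w ζ * (((Ψ ζ : ℂ) + z)⁻¹ * c).im
      = ((∫ ζ in Ioi (0:ℝ), (w ζ : ℂ) * ((Ψ ζ : ℂ) + z)⁻¹) * c).im := by
    simp only [hmul]
    rw [← integral_mul_const]
    exact integral_im hwgc
  rw [hb] at hmain
  rw [div_eq_mul_inv, Complex.inv_def, ← mul_assoc, Complex.im_mul_ofReal]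
  exact mul_nonpos_of_nonpos_of_nonneg hmain (inv_nonneg.2 (Complex.normSq_nonneg _))
end

section
/- Let Ψ : (0,∞) → [0,∞) be strictly increasing with ∫₀^∞ 1/(1+Ψ(ζ)) dζ < ∞. Then for all ξ₁, ξ₂ > 0 and every z ∈ ℂ with Im z > 0, one has φ(z) ≠ 0 and Im( φ(ξ₁,ξ₂,z) − φ(ξ₁,z)·φ(ξ₂,z)/φ(z) ) ≤ 0. -/
open MeasureTheory Filter Topology Set

/-- `φ(ξ₁,ξ₂,z) = (1/π) ∫₀^∞ (ξ₁²/(ξ₁²+ζ²))(ξ₂²/(ξ₂²+ζ²)) / (Ψ(ζ)+z) dζ`. -/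
noncomputable def phi2 (Ψ : ℝ → ℝ) (ξ₁ ξ₂ : ℝ) (z : ℂ) : ℂ :=
  (Real.pi : ℂ)⁻¹ * ∫ ζ in Ioi (0:ℝ),
    ((ξ₁^2 / (ξ₁^2 + ζ^2) * (ξ₂^2 / (ξ₂^2 + ζ^2)) : ℝ) : ℂ) * ((Ψ ζ : ℂ) + z)⁻¹

/-- A bounded antitone weight against a function with mean zero that changes sign at most once,
from nonpositive to nonnegative, has a nonpositive integral. -/
theorem integral_mul_nonpos_of_single_crossing {g k : ℝ → ℝ}
    (hg : AntitoneOn g (Ioi 0)) (hg0 : ∀ t ∈ Ioi (0:ℝ), 0 ≤ g t)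
    (hg1 : ∀ t ∈ Ioi (0:ℝ), g t ≤ 1)
    (hk : ∀ s ∈ Ioi (0:ℝ), ∀ t ∈ Ioi (0:ℝ), s ≤ t → 0 < k s → 0 ≤ k t)
    (hki : IntegrableOn k (Ioi 0)) (hgki : IntegrableOn (fun t => g t * k t) (Ioi 0))
    (hk0 : ∫ t in Ioi (0:ℝ), k t = 0) :
    ∫ t in Ioi (0:ℝ), g t * k t ≤ 0 := by
  set S : Set ℝ := g '' {s | s ∈ Ioi (0:ℝ) ∧ 0 < k s}
  have hS : BddAbove S := ⟨1, by rintro _ ⟨s, hs, rfl⟩; exact hg1 s hs.1⟩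
  have hpt : ∀ t ∈ Ioi (0:ℝ), (g t - sSup S) * k t ≤ 0 := by
    intro t ht
    rcases lt_trichotomy (k t) 0 with h | h | h
    · refine mul_nonpos_of_nonneg_of_nonpos (sub_nonneg.2 (Real.sSup_le ?_ (hg0 t ht))) h.le
      rintro _ ⟨s, hs, rfl⟩
      refine hg ht hs.1 (le_of_not_ge fun hst => ?_)
      exact absurd (hk s hs.1 t ht hst hs.2) (not_le.2 h)
    · simp [h]
    · exact mul_nonpos_of_nonpos_of_nonneg (sub_nonpos.2 (le_csSup hS ⟨t, ⟨ht, h⟩, rfl⟩)) h.le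
  have h : ∫ t in Ioi (0:ℝ), (g t - sSup S) * k t = ∫ t in Ioi (0:ℝ), g t * k t := by
    simp_rw [sub_mul]
    rw [integral_sub hgki (hki.const_mul _), integral_const_mul, hk0, mul_zero, sub_zero]
  rw [← h]
  exact setIntegral_nonpos measurableSet_Ioi hpt

theorem integrableOn_inv_add {Ψ : ℝ → ℝ} (hmono : MonotoneOn Ψ (Ioi 0))
    (hnonneg : ∀ ζ ∈ Ioi (0:ℝ), 0 ≤ Ψ ζ)
    (hint : IntegrableOn (fun ζ => 1 / (1 + Ψ ζ)) (Ioi 0)) {z : ℂ} (hz : 0 < z.im) :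
    IntegrableOn (fun ζ => ((Ψ ζ : ℂ) + z)⁻¹) (Ioi 0) := by
  have hm : AEMeasurable Ψ (volume.restrict (Ioi 0)) :=
    aemeasurable_restrict_of_monotoneOn measurableSet_Ioi hmono
  refine Integrable.mono' (hint.const_mul ((1 + ‖z‖) / z.im + 1)) ?_ ?_
  · exact ((Complex.measurable_ofReal.comp_aemeasurable hm).add_const z).inv.aestronglyMeasurable
  · filter_upwards [ae_restrict_mem measurableSet_Ioi] with t ht
    have h0 := hnonneg t ht
    have him : z.im ≤ ‖(Ψ t : ℂ) + z‖ := by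
      simpa using (le_abs_self _).trans (Complex.abs_im_le_norm ((Ψ t : ℂ) + z))
    have hw : 0 < ‖(Ψ t : ℂ) + z‖ := hz.trans_le him
    have htri : Ψ t ≤ ‖(Ψ t : ℂ) + z‖ + ‖z‖ := by
      simpa [abs_of_nonneg h0] using norm_sub_le ((Ψ t : ℂ) + z) z
    have h1 : 1 + ‖z‖ ≤ (1 + ‖z‖) / z.im * ‖(Ψ t : ℂ) + z‖ := by
      rw [div_mul_eq_mul_div, le_div_iff₀ hz]
      gcongr
    rw [norm_inv, mul_one_div, le_div_iff₀ (by linarith), inv_mul_le_iff₀ hw]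
    linarith

theorem antitoneOn_sq_div_sq_add_sq {ξ : ℝ} (hξ : 0 < ξ) :
    AntitoneOn (fun ζ : ℝ => ξ^2 / (ξ^2 + ζ^2)) (Ioi 0) := by
  intro s hs t _ hst
  have : 0 < s := hs
  dsimp only
  gcongr

theorem sq_div_sq_add_sq_nonneg (ξ ζ : ℝ) : 0 ≤ ξ^2 / (ξ^2 + ζ^2) := by positivity

theorem sq_div_sq_add_sq_le_one (ξ ζ : ℝ) : ξ^2 / (ξ^2 + ζ^2) ≤ 1 :=
  div_le_one_of_le₀ (by nlinarith [sq_nonneg ζ]) (by positivity)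

theorem integrableOn_sq_div_mul {f : ℝ → ℂ} (hf : IntegrableOn f (Ioi 0)) (ξ : ℝ) :
    IntegrableOn (fun ζ => ((ξ^2 / (ξ^2 + ζ^2) : ℝ) : ℂ) * f ζ) (Ioi 0) := by
  refine Integrable.bdd_mul (c := 1) hf ?_ (Eventually.of_forall fun ζ => ?_)
  · exact (Complex.measurable_ofReal.comp (by fun_prop)).aestronglyMeasurable
  · rw [Complex.norm_real, Real.norm_of_nonneg (sq_div_sq_add_sq_nonneg ξ ζ)]
    exact sq_div_sq_add_sq_le_one ξ ζ

/-- Complex form of `integral_mul_nonpos_of_single_crossing` for the weight `ξ²/(ξ²+ζ²)`. -/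
theorem im_integral_sq_div_mul_nonpos {f : ℝ → ℂ} {ρ m : ℝ → ℝ}
    (hf : IntegrableOn f (Ioi 0)) (hf0 : (∫ ζ in Ioi (0:ℝ), f ζ).im = 0)
    (hfm : ∀ ζ ∈ Ioi (0:ℝ), (f ζ).im = ρ ζ * m ζ) (hρ : ∀ ζ, 0 ≤ ρ ζ)
    (hm : MonotoneOn m (Ioi 0)) {ξ : ℝ} (hξ : 0 < ξ) :
    (∫ ζ in Ioi (0:ℝ), ((ξ^2 / (ξ^2 + ζ^2) : ℝ) : ℂ) * f ζ).im ≤ 0 := by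
  have him : ∀ {u : ℝ → ℂ}, IntegrableOn u (Ioi 0) →
      (∫ ζ in Ioi (0:ℝ), u ζ).im = ∫ ζ in Ioi (0:ℝ), (u ζ).im :=
    fun hu => (integral_im hu).symm
  have hgf := integrableOn_sq_div_mul hf ξ
  rw [him hgf]
  simp_rw [Complex.im_ofReal_mul]
  refine integral_mul_nonpos_of_single_crossing (antitoneOn_sq_div_sq_add_sq hξ)
    (fun t _ => sq_div_sq_add_sq_nonneg ξ t) (fun t _ => sq_div_sq_add_sq_le_one ξ t) ?_ hf.im
    (by simpa only [IntegrableOn, Complex.im_ofReal_mul, RCLike.im_to_complex] using hgf.im)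
    (by rw [← him hf, hf0])
  intro s hs t ht hst hpos
  rw [hfm s hs] at hpos
  rw [hfm t ht]
  exact mul_nonneg (hρ t) ((pos_of_mul_pos_right hpos (hρ s)).le.trans (hm hs ht hst))

theorem im_phiTilde_nonpos (Ψ : ℝ → ℝ)
    (hmono : StrictMonoOn Ψ (Ioi 0))
    (hnonneg : ∀ ζ ∈ Ioi (0:ℝ), 0 ≤ Ψ ζ)
    (hint : IntegrableOn (fun ζ => 1 / (1 + Ψ ζ)) (Ioi 0))
    (ξ₁ ξ₂ : ℝ) (hξ₁ : 0 < ξ₁) (hξ₂ : 0 < ξ₂) (z : ℂ) (hz : 0 < z.im) :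
    phi Ψ z ≠ 0 ∧
      (phi2 Ψ ξ₁ ξ₂ z - phi1 Ψ ξ₁ z * phi1 Ψ ξ₂ z / phi Ψ z).im ≤ 0 := by
  have hh := integrableOn_inv_add hmono.monotoneOn hnonneg hint hz
  have hns : ∀ ζ, 0 < Complex.normSq ((Ψ ζ : ℂ) + z) := fun ζ =>
    Complex.normSq_pos.2 fun h => hz.ne' (by simpa using congrArg Complex.im h)
  have hg₂ := integrableOn_sq_div_mul hh ξ₂
  have hg₁ := integrableOn_sq_div_mul hh ξ₁
  have hg₁₂ := integrableOn_sq_div_mul hg₂ ξ₁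
  simp only [phi, phi1, phi2, Complex.ofReal_mul, mul_assoc]
  set I := ∫ ζ in Ioi (0:ℝ), ((Ψ ζ : ℂ) + z)⁻¹ with hI
  set I₁ := ∫ ζ in Ioi (0:ℝ), ((ξ₁^2 / (ξ₁^2 + ζ^2) : ℝ) : ℂ) * ((Ψ ζ : ℂ) + z)⁻¹ with hI₁
  set I₂ := ∫ ζ in Ioi (0:ℝ), ((ξ₂^2 / (ξ₂^2 + ζ^2) : ℝ) : ℂ) * ((Ψ ζ : ℂ) + z)⁻¹ with hI₂
  set I₁₂ := ∫ ζ in Ioi (0:ℝ), ((ξ₁^2 / (ξ₁^2 + ζ^2) : ℝ) : ℂ) *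
    (((ξ₂^2 / (ξ₂^2 + ζ^2) : ℝ) : ℂ) * ((Ψ ζ : ℂ) + z)⁻¹) with hI₁₂
  have hIim : I.im < 0 := by
    have h1 : I.im = ∫ ζ in Ioi (0:ℝ), (((Ψ ζ : ℂ) + z)⁻¹).im := (integral_im hh).symm
    have h2 : 0 < ∫ ζ in Ioi (0:ℝ), -(((Ψ ζ : ℂ) + z)⁻¹).im := by
      have hpos : ∀ ζ, 0 < -(((Ψ ζ : ℂ) + z)⁻¹).im := fun ζ => by
        rw [Complex.inv_im]
        have := div_pos hz (hns ζ)
        simpa [neg_div] using this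
      rw [setIntegral_pos_iff_support_of_nonneg_ae (Eventually.of_forall fun ζ => (hpos ζ).le)
        hh.im.neg]
      have : Function.support (fun ζ => -(((Ψ ζ : ℂ) + z)⁻¹).im) = univ :=
        eq_univ_of_forall fun ζ => (hpos ζ).ne'
      rw [this]
      simp
    rw [integral_neg, ← h1] at h2
    linarith
  have hI0 : I ≠ 0 := fun h => by simp [h] at hIim
  have hpi : (Real.pi : ℂ)⁻¹ ≠ 0 := by simp [Real.pi_ne_zero]
  refine ⟨mul_ne_zero hpi hI0, ?_⟩
  set c := I₂ / I with hc
  have hcim : c.im ≤ 0 := by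
    have h1 : (∫ ζ in Ioi (0:ℝ), ((ξ₂^2 / (ξ₂^2 + ζ^2) : ℝ) : ℂ) *
        (((Ψ ζ : ℂ) + z)⁻¹ * I⁻¹)).im ≤ 0 := by
      refine im_integral_sq_div_mul_nonpos (hh.mul_const _)
        (ρ := fun ζ => (Complex.normSq ((Ψ ζ : ℂ) + z))⁻¹ * (Complex.normSq I)⁻¹)
        (m := fun ζ => -((Ψ ζ + z.re) * I.im + z.im * I.re)) ?_ ?_ ?_ ?_ hξ₂
      · rw [integral_mul_const, ← hI, mul_inv_cancel₀ hI0, Complex.one_im]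
      · intro ζ _
        simp [Complex.inv_im, Complex.inv_re, Complex.mul_im]
        ring
      · intro ζ
        exact mul_nonneg (inv_nonneg.2 (hns ζ).le) (inv_nonneg.2 (Complex.normSq_nonneg _))
      · intro s hs t ht hst
        have := hmono.monotoneOn hs ht hst
        dsimp only
        nlinarith
    simp_rw [← mul_assoc] at h1
    rwa [integral_mul_const, ← hI₂, ← div_eq_mul_inv] at h1
  have hmain : (∫ ζ in Ioi (0:ℝ), ((ξ₁^2 / (ξ₁^2 + ζ^2) : ℝ) : ℂ) *
      (((ξ₂^2 / (ξ₂^2 + ζ^2) : ℝ) : ℂ) * ((Ψ ζ : ℂ) + z)⁻¹ - c * ((Ψ ζ : ℂ) + z)⁻¹)).im ≤ 0 := by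
    refine im_integral_sq_div_mul_nonpos
      (f := fun ζ => ((ξ₂^2 / (ξ₂^2 + ζ^2) : ℝ) : ℂ) * ((Ψ ζ : ℂ) + z)⁻¹ - c * ((Ψ ζ : ℂ) + z)⁻¹)
      (hg₂.sub (hh.const_mul c))
      (ρ := fun ζ => (Complex.normSq ((Ψ ζ : ℂ) + z))⁻¹)
      (m := fun ζ => -(z.im * (ξ₂^2 / (ξ₂^2 + ζ^2) - c.re)) - c.im * (Ψ ζ + z.re)) ?_ ?_ ?_ ?_ hξ₁
    · rw [integral_sub hg₂ (hh.const_mul c), integral_const_mul, ← hI, ← hI₂, hc,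
        div_mul_cancel₀ _ hI0, sub_self, Complex.zero_im]
    · intro ζ _
      rw [← sub_mul, Complex.mul_im, Complex.inv_im, Complex.inv_re, Complex.sub_im,
        Complex.sub_re, Complex.ofReal_re, Complex.ofReal_im, Complex.add_re, Complex.add_im,
        Complex.ofReal_re, Complex.ofReal_im]
      ring
    · exact fun ζ => inv_nonneg.2 (hns ζ).le
    · intro s hs t ht hst
      have h1 := hmono.monotoneOn hs ht hst
      have h2 := antitoneOn_sq_div_sq_add_sq hξ₂ hs ht hst
      dsimp only at h2 ⊢
      nlinarith [mul_le_mul_of_nonneg_left h2 hz.le]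
  have heq : (Real.pi : ℂ)⁻¹ * I₁₂ - (Real.pi : ℂ)⁻¹ * (I₁ * ((Real.pi : ℂ)⁻¹ * I₂)) /
      ((Real.pi : ℂ)⁻¹ * I) = ((Real.pi⁻¹ : ℝ) : ℂ) * (I₁₂ - c * I₁) := by
    rw [hc, Complex.ofReal_inv]
    field_simp
  have hsplit : ∫ ζ in Ioi (0:ℝ), ((ξ₁^2 / (ξ₁^2 + ζ^2) : ℝ) : ℂ) *
      (((ξ₂^2 / (ξ₂^2 + ζ^2) : ℝ) : ℂ) * ((Ψ ζ : ℂ) + z)⁻¹ - c * ((Ψ ζ : ℂ) + z)⁻¹) =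
      I₁₂ - c * I₁ := by
    rw [hI₁₂, hI₁, ← integral_const_mul, ← integral_sub hg₁₂ (hg₁.const_mul c)]
    exact integral_congr_ae (Eventually.of_forall fun ζ => by ring)
  rw [hsplit] at hmain
  have hgoal := mul_nonpos_of_nonneg_of_nonpos (inv_nonneg.2 Real.pi_pos.le) hmain
  rw [← Complex.im_ofReal_mul, ← heq] at hgoal
  exact hgoal
end

section
/- For all complex numbers w, w₁, w₂ with Im w ≠ 0, the following identity holds: Im(w₁w₂/w) = (Im w₁ · Im w₂)/Im w + (Im(w₁/w) · Im(w₂/w))/Im(1/w). (Note that Im w ≠ 0 implies w ≠ 0 and Im(1/w) ≠ 0, so all terms are well defined.) -/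
theorem im_mul_div_identity (w w₁ w₂ : ℂ) (hw : w.im ≠ 0) :
    (w₁ * w₂ / w).im =
      (w₁.im * w₂.im) / w.im + ((w₁ / w).im * (w₂ / w).im) / (1 / w).im := by
  have hn : w.re ^ 2 + w.im ^ 2 ≠ 0 := by positivity
  simp only [Complex.div_im, Complex.mul_re, Complex.mul_im, Complex.one_re, Complex.one_im,
    Complex.normSq_apply, ← pow_two, zero_mul, zero_div, one_mul, zero_sub]
  field_simp
  ring
end

section
/- Assume Ψ : (0,∞) → [0,∞) is strictly increasing, twice continuously differentiable with Ψ'(ζ) > 0 for all ζ > 0, and ∫₀^∞ 1/(1+Ψ(ζ)) dζ < ∞. Let λ > 0 and let f : (0,∞) → ℝ be bounded and continuously differentiable. Then the principal value pv∫₀^∞ f(ζ)/(Ψ(λ)−Ψ(ζ)) dζ exists, and lim_{ε→0⁺} ∫₀^∞ f(ζ)/(Ψ(ζ)−Ψ(λ)+iε) dζ = −pv∫₀^∞ f(ζ)/(Ψ(λ)−Ψ(ζ)) dζ − iπ f(λ)/Ψ'(λ). -/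
open MeasureTheory Filter Topology Set

/-- Integrating the logarithmic derivative of `u + iε` across a sign change of `u` produces, as
`ε → 0⁺`, the jump `-iπ` of the complex logarithm. -/
theorem tendsto_integral_deriv_div_add_mul_I {u u' : ℝ → ℝ} {a b : ℝ} (hab : a ≤ b)
    (hu : ∀ x ∈ Icc a b, HasDerivAt u (u' x) x) (hu' : ContinuousOn u' (Icc a b))
    (ha : u a < 0) (hb : 0 < u b) :
    Tendsto (fun ε : ℝ => ∫ x in a..b, (u' x : ℂ) / ((u x : ℂ) + (ε : ℂ) * Complex.I))
      (𝓝[>] 0) (𝓝 ((Real.log (u b) - Real.log (u a) : ℝ) - (Real.pi : ℂ) * Complex.I)) := by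
  have hlim : ∀ c : ℝ, Tendsto (fun ε : ℝ => (c : ℂ) + (ε : ℂ) * Complex.I) (𝓝[>] 0)
      (𝓝 (c : ℂ)) := fun c => by
    have : Continuous (fun ε : ℝ => (c : ℂ) + (ε : ℂ) * Complex.I) := by fun_prop
    simpa using (this.tendsto 0).mono_left nhdsWithin_le_nhds
  have hlogb : Tendsto (fun ε : ℝ => Complex.log ((u b : ℂ) + (ε : ℂ) * Complex.I)) (𝓝[>] 0)
      (𝓝 (Real.log (u b) : ℂ)) := by
    rw [Complex.ofReal_log hb.le]
    exact (hlim (u b)).clog (Complex.ofReal_mem_slitPlane.2 hb)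
  have hloga : Tendsto (fun ε : ℝ => Complex.log ((u a : ℂ) + (ε : ℂ) * Complex.I)) (𝓝[>] 0)
      (𝓝 (Real.log (u a) + Real.pi * Complex.I)) := by
    have h := Complex.tendsto_log_nhdsWithin_im_nonneg_of_re_neg_of_im_zero
      (z := (u a : ℂ)) (by simpa using ha) (by simp)
    rw [Complex.norm_real, Real.norm_eq_abs, Real.log_abs] at h
    refine h.comp (tendsto_nhdsWithin_iff.2 ⟨hlim (u a), ?_⟩)
    filter_upwards [self_mem_nhdsWithin] with ε hε
    simpa using (mem_Ioi.1 hε).le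
  have hlog := hlogb.sub hloga
  have heq : ((Real.log (u b) : ℂ) - (Real.log (u a) + Real.pi * Complex.I)) =
      ((Real.log (u b) - Real.log (u a) : ℝ) - (Real.pi : ℂ) * Complex.I) := by
    push_cast; ring
  rw [heq] at hlog
  refine hlog.congr' ?_
  filter_upwards [self_mem_nhdsWithin] with ε hε
  have hslit : ∀ x, (u x : ℂ) + (ε : ℂ) * Complex.I ∈ Complex.slitPlane := fun x =>
    Or.inr (by simpa using (mem_Ioi.1 hε).ne')
  symm
  refine intervalIntegral.integral_eq_sub_of_hasDerivAt
    (f := fun x => Complex.log ((u x : ℂ) + (ε : ℂ) * Complex.I)) ?_ ?_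
  · intro x hx
    rw [uIcc_of_le hab] at hx
    exact ((hu x hx).ofReal_comp.add_const _).clog_real (hslit x)
  · refine ContinuousOn.intervalIntegrable ?_
    rw [uIcc_of_le hab]
    have huc : ContinuousOn u (Icc a b) := fun x hx => (hu x hx).continuousAt.continuousWithinAt
    refine ContinuousOn.div (by fun_prop) (by fun_prop) fun x _ =>
      Complex.slitPlane_ne_zero (hslit x)

theorem Ioc_diff_Icc_symm {a b c ε : ℝ} (hε : 0 < ε) (ha : a < c - ε) (hb : c + ε < b) :
    Ioc a b \ Icc (c - ε) (c + ε) = Ioo a (c - ε) ∪ Ioc (c + ε) b := by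
  ext x
  simp only [Set.mem_sdiff, mem_Ioc, mem_Icc, mem_union, mem_Ioo, not_and_or, not_le]
  constructor
  · rintro ⟨⟨h1, h2⟩, h | h⟩
    · exact Or.inl ⟨h1, h⟩
    · exact Or.inr ⟨h, h2⟩
  · rintro (⟨h1, h2⟩ | ⟨h1, h2⟩)
    · exact ⟨⟨h1, by linarith⟩, Or.inl h2⟩
    · exact ⟨⟨by linarith, h2⟩, Or.inr h1⟩

theorem tendsto_log_sub_log_symm {u : ℝ → ℝ} {c d : ℝ} (hu : HasDerivAt u d c) (hc : u c = 0)
    (hd : 0 < d) :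
    Tendsto (fun ε : ℝ => Real.log (u (c - ε)) - Real.log (u (c + ε))) (𝓝[>] 0) (𝓝 0) := by
  have hs := hasDerivAt_iff_tendsto_slope_zero.1 hu
  simp only [hc, sub_zero, smul_eq_mul] at hs
  have hp : Tendsto (fun ε : ℝ => ε⁻¹ * u (c + ε)) (𝓝[>] 0) (𝓝 d) :=
    hs.mono_left (nhdsWithin_mono _ fun x hx => (mem_Ioi.1 hx).ne')
  have hneg : Tendsto (fun ε : ℝ => -ε) (𝓝[>] 0) (𝓝[≠] 0) := by
    refine tendsto_nhdsWithin_iff.2 ⟨?_, ?_⟩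
    · simpa using (continuous_neg.tendsto (0 : ℝ)).mono_left nhdsWithin_le_nhds
    · filter_upwards [self_mem_nhdsWithin] with ε hε
      simpa using (mem_Ioi.1 hε).ne'
  have hm := hs.comp hneg
  have hlog := (hm.log hd.ne').sub (hp.log hd.ne')
  rw [sub_self] at hlog
  refine hlog.congr' ?_
  filter_upwards [self_mem_nhdsWithin, hm.eventually_ne hd.ne', hp.eventually_ne hd.ne']
    with ε hε h1 h2
  have hε : 0 < ε := hε
  simp only [Function.comp_apply, ← sub_eq_add_neg] at h1 ⊢
  rw [Real.log_mul (left_ne_zero_of_mul h1) (right_ne_zero_of_mul h1),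
    Real.log_mul (left_ne_zero_of_mul h2) (right_ne_zero_of_mul h2), inv_neg, Real.log_neg_eq_log]
  ring

/-- The logarithmic derivative of `u` is integrable away from a simple zero `c` of `u`. -/
theorem integrableOn_deriv_div_Ioc_diff_Icc {u u' : ℝ → ℝ} {a b c ε : ℝ}
    (hu : ContinuousOn u (Icc a b)) (hu' : ContinuousOn u' (Icc a b))
    (hne : ∀ x ∈ Icc a b, x ≠ c → u x ≠ 0)
    (hε : 0 < ε) (ha : a < c - ε) (hb : c + ε < b) :
    IntegrableOn (fun x => u' x / u x) (Ioc a b \ Icc (c - ε) (c + ε)) := by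
  rw [Ioc_diff_Icc_symm hε ha hb]
  have hl : Icc a (c - ε) ⊆ Icc a b := Icc_subset_Icc_right (by linarith)
  have hr : Icc (c + ε) b ⊆ Icc a b := Icc_subset_Icc_left (by linarith)
  refine IntegrableOn.union ?_ ?_
  · refine IntegrableOn.mono_set (ContinuousOn.integrableOn_Icc ?_) Ioo_subset_Icc_self
    exact (hu'.mono hl).div (hu.mono hl) fun x hx => hne x (hl hx) (by linarith [hx.2] : x < c).ne
  · refine IntegrableOn.mono_set (ContinuousOn.integrableOn_Icc ?_) Ioc_subset_Icc_self
    exact (hu'.mono hr).div (hu.mono hr) fun x hx => hne x (hr hx) (by linarith [hx.1] : c < x).ne'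

/-- The principal value of the integral of the logarithmic derivative of `u` across a simple
zero. -/
theorem tendsto_integral_deriv_div_Ioc_diff_Icc {u u' : ℝ → ℝ} {a b c : ℝ} (hc : c ∈ Ioo a b)
    (hu : ∀ x ∈ Icc a b, HasDerivAt u (u' x) x) (hu' : ContinuousOn u' (Icc a b))
    (hne : ∀ x ∈ Icc a b, x ≠ c → u x ≠ 0) (huc : u c = 0) (hd : 0 < u' c) :
    Tendsto (fun ε : ℝ => ∫ x in Ioc a b \ Icc (c - ε) (c + ε), u' x / u x)
      (𝓝[>] 0) (𝓝 (Real.log (u b) - Real.log (u a))) := by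
  have hlog := (tendsto_log_sub_log_symm (hu c (Ioo_subset_Icc_self hc)) huc hd).add_const
    (Real.log (u b) - Real.log (u a))
  rw [zero_add] at hlog
  refine hlog.congr' ?_
  have hcont : ContinuousOn u (Icc a b) := fun x hx => (hu x hx).continuousAt.continuousWithinAt
  filter_upwards [self_mem_nhdsWithin,
    nhdsWithin_le_nhds (Iio_mem_nhds (sub_pos.2 hc.1)),
    nhdsWithin_le_nhds (Iio_mem_nhds (sub_pos.2 hc.2))] with ε hε h1 h2
  have hε : 0 < ε := hε
  have ha : a < c - ε := by have := mem_Iio.1 h1; linarith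
  have hb : c + ε < b := by have := mem_Iio.1 h2; linarith
  have hint := integrableOn_deriv_div_Ioc_diff_Icc hcont hu' hne hε ha hb
  have hl : Icc a (c - ε) ⊆ Icc a b := Icc_subset_Icc_right (by linarith)
  have hr : Icc (c + ε) b ⊆ Icc a b := Icc_subset_Icc_left (by linarith)
  have hftc : ∀ p q, p ≤ q → Icc p q ⊆ Icc a b → c ∉ Icc p q →
      ∫ x in p..q, u' x / u x = Real.log (u q) - Real.log (u p) := by
    intro p q hpq hsub hcpq
    have hne' : ∀ x ∈ Icc p q, u x ≠ 0 := fun x hx =>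
      hne x (hsub hx) fun h => hcpq (h ▸ hx)
    refine intervalIntegral.integral_eq_sub_of_hasDerivAt
      (f := fun x => Real.log (u x)) (fun x hx => ?_) (ContinuousOn.intervalIntegrable ?_)
    · rw [uIcc_of_le hpq] at hx
      exact (hu x (hsub hx)).log (hne' x hx)
    · rw [uIcc_of_le hpq]
      exact (hu'.mono hsub).div (hcont.mono hsub) hne'
  rw [Ioc_diff_Icc_symm hε ha hb] at hint ⊢
  rw [setIntegral_union (disjoint_left.2 fun x hx hx' => by linarith [hx.2, hx'.1])
    measurableSet_Ioc hint.left_of_union hint.right_of_union, ← integral_Ioc_eq_integral_Ioo,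
    ← intervalIntegral.integral_of_le ha.le, ← intervalIntegral.integral_of_le hb.le,
    hftc _ _ ha.le hl (fun h => by linarith [h.2]), hftc _ _ hb.le hr (fun h => by linarith [h.1])]
  ring

theorem norm_div_add_mul_I_le (g u ε : ℝ) (hu : u ≠ 0) :
    ‖(g : ℂ) / ((u : ℂ) + (ε : ℂ) * Complex.I)‖ ≤ ‖g / u‖ := by
  rw [norm_div, norm_div, Complex.norm_real]
  refine div_le_div_of_nonneg_left (norm_nonneg _) (norm_pos_iff.2 hu) ?_
  simpa using Complex.abs_re_le_norm ((u : ℂ) + (ε : ℂ) * Complex.I)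

theorem aestronglyMeasurable_div_add_mul_I {μ : Measure ℝ} {g u : ℝ → ℝ}
    (hg : AEMeasurable g μ) (hu : AEMeasurable u μ) (ε : ℝ) :
    AEStronglyMeasurable (fun x => (g x : ℂ) / ((u x : ℂ) + (ε : ℂ) * Complex.I)) μ := by
  refine AEMeasurable.aestronglyMeasurable ?_
  fun_prop

theorem integrable_div_add_mul_I {μ : Measure ℝ} {g u : ℝ → ℝ}
    (hg : AEMeasurable g μ) (hu : AEMeasurable u μ) (hne : ∀ᵐ x ∂μ, u x ≠ 0)
    (hint : Integrable (fun x => g x / u x) μ) (ε : ℝ) :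
    Integrable (fun x => (g x : ℂ) / ((u x : ℂ) + (ε : ℂ) * Complex.I)) μ :=
  hint.mono (aestronglyMeasurable_div_add_mul_I hg hu ε)
    (hne.mono fun x hx => norm_div_add_mul_I_le (g x) (u x) ε hx)

theorem tendsto_integral_div_add_mul_I {μ : Measure ℝ} {g u : ℝ → ℝ}
    (hg : AEMeasurable g μ) (hu : AEMeasurable u μ) (hne : ∀ᵐ x ∂μ, u x ≠ 0)
    (hint : Integrable (fun x => g x / u x) μ) :
    Tendsto (fun ε : ℝ => ∫ x, (g x : ℂ) / ((u x : ℂ) + (ε : ℂ) * Complex.I) ∂μ)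
      (𝓝[>] 0) (𝓝 ((∫ x, g x / u x ∂μ : ℝ) : ℂ)) := by
  rw [← integral_complex_ofReal]
  refine tendsto_integral_filter_of_dominated_convergence (fun x => ‖g x / u x‖)
    (Eventually.of_forall fun ε => aestronglyMeasurable_div_add_mul_I hg hu ε)
    (Eventually.of_forall fun ε => hne.mono fun x hx => norm_div_add_mul_I_le (g x) (u x) ε hx)
    hint.norm (hne.mono fun x hx => ?_)
  have hden : Tendsto (fun ε : ℝ => (u x : ℂ) + (ε : ℂ) * Complex.I) (𝓝[>] 0) (𝓝 (u x : ℂ)) := by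
    have : Continuous (fun ε : ℝ => (u x : ℂ) + (ε : ℂ) * Complex.I) := by fun_prop
    simpa using (this.tendsto 0).mono_left nhdsWithin_le_nhds
  rw [Complex.ofReal_div]
  exact tendsto_const_nhds.div hden (Complex.ofReal_ne_zero.2 hx)

theorem tendsto_setIntegral_diff_Icc {G : ℝ → ℝ} {s : Set ℝ} (hG : IntegrableOn G s) (c : ℝ) :
    Tendsto (fun ε : ℝ => ∫ x in s \ Icc (c - ε) (c + ε), G x) (𝓝[>] 0) (𝓝 (∫ x in s, G x)) := by
  have heq : ∀ ε : ℝ, ∫ x in s \ Icc (c - ε) (c + ε), G x =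
      ∫ x in s, (Icc (c - ε) (c + ε))ᶜ.indicator G x := fun ε => by
    rw [setIntegral_indicator measurableSet_Icc.compl, sdiff_eq]
  simp only [heq]
  refine tendsto_integral_filter_of_dominated_convergence (fun x => ‖G x‖)
    (Eventually.of_forall fun ε => hG.aestronglyMeasurable.indicator measurableSet_Icc.compl)
    (Eventually.of_forall fun ε => Eventually.of_forall fun x => norm_indicator_le_norm_self _ _)
    hG.norm ?_
  filter_upwards [ae_restrict_of_ae (Measure.ae_ne volume c)] with x hx
  refine tendsto_const_nhds.congr' ?_
  filter_upwards [nhdsWithin_le_nhds (Iio_mem_nhds (abs_pos.2 (sub_ne_zero.2 hx)))] with ε hε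
  rw [indicator_of_mem]
  intro h
  have : |x - c| ≤ ε := abs_le.2 ⟨by linarith [h.1], by linarith [h.2]⟩
  exact absurd (mem_Iio.1 hε) (not_lt.2 this)

/-- A quotient whose numerator vanishes at a simple zero of the denominator is integrable. -/
theorem integrableOn_div_Icc_of_zero {g u : ℝ → ℝ} {a b c d : ℝ} (hc : c ∈ Ioo a b)
    (hg : ContinuousOn g (Icc a b)) (hgd : DifferentiableAt ℝ g c) (hgc : g c = 0)
    (hu : ContinuousOn u (Icc a b)) (hud : HasDerivAt u d c) (huc : u c = 0) (hd : d ≠ 0)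
    (hne : ∀ x ∈ Icc a b, x ≠ c → u x ≠ 0) :
    IntegrableOn (fun x => g x / u x) (Icc a b) := by
  have hnhds : Icc a b ∈ 𝓝 c := Icc_mem_nhds hc.1 hc.2
  have hcont : ContinuousOn (fun x => dslope g c x / dslope u c x) (Icc a b) := by
    refine ((continuousOn_dslope hnhds).2 ⟨hg, hgd⟩).div
      ((continuousOn_dslope hnhds).2 ⟨hu, hud.differentiableAt⟩) fun x hx => ?_
    rcases eq_or_ne x c with rfl | hxc
    · rwa [dslope_same, hud.deriv]
    · rw [dslope_of_ne _ hxc, slope_def_field, huc, sub_zero]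
      exact div_ne_zero (hne x hx hxc) (sub_ne_zero.2 hxc)
  refine hcont.integrableOn_Icc.congr ?_
  filter_upwards [ae_restrict_of_ae (Measure.ae_ne volume c)] with x hx
  rw [dslope_of_ne _ hx, dslope_of_ne _ hx, slope_def_field, slope_def_field, huc, hgc, sub_zero,
    sub_zero, div_div_div_cancel_right₀ (sub_ne_zero.2 hx)]

/-- Away from the level `y`, the function `1 / |Ψ - y|` is dominated by a multiple of
`1 / (1 + Ψ)`. -/
theorem integrableOn_div_sub_of_le_abs {Ψ f : ℝ → ℝ} {s : Set ℝ} {y δ M : ℝ}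
    (hs : MeasurableSet s) (hΨ : ContinuousOn Ψ s) (hf : ContinuousOn f s)
    (hnonneg : ∀ x ∈ s, 0 ≤ Ψ x) (hy : 0 ≤ y) (hint : IntegrableOn (fun x => 1 / (1 + Ψ x)) s)
    (hfb : ∀ x ∈ s, |f x| ≤ M) (hδ : 0 < δ) (hfar : ∀ x ∈ s, δ ≤ |Ψ x - y|) :
    IntegrableOn (fun x => f x / (Ψ x - y)) s := by
  refine (hint.const_mul (M * ((1 + y) / δ + 1))).mono' ?_ ?_
  · refine ContinuousOn.aestronglyMeasurable (hf.div (hΨ.sub continuousOn_const) fun x hx => ?_) hs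
    exact abs_pos.1 (hδ.trans_le (hfar x hx))
  · filter_upwards [ae_restrict_mem hs] with x hx
    have hpos : 0 < |Ψ x - y| := hδ.trans_le (hfar x hx)
    have hΨx := hnonneg x hx
    have hM : 0 ≤ M := (abs_nonneg _).trans (hfb x hx)
    have hle : 1 + Ψ x ≤ ((1 + y) / δ + 1) * |Ψ x - y| := by
      have h1 : 1 + y ≤ (1 + y) / δ * |Ψ x - y| :=
        calc 1 + y = (1 + y) / δ * δ := by field_simp
          _ ≤ _ := mul_le_mul_of_nonneg_left (hfar x hx) (by positivity)
      linarith [le_abs_self (Ψ x - y)]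
    rw [norm_div, Real.norm_eq_abs, Real.norm_eq_abs, mul_one_div,
      div_le_div_iff₀ hpos (by linarith)]
    calc |f x| * (1 + Ψ x) ≤ M * (((1 + y) / δ + 1) * |Ψ x - y|) :=
          mul_le_mul (hfb x hx) hle (by linarith) hM
      _ = _ := by ring

theorem sokhotski_plemelj_limit (Ψ Ψ' Ψ'' f f' : ℝ → ℝ) (M : ℝ)
    (hmono : StrictMonoOn Ψ (Ioi 0))
    (hnonneg : ∀ ζ ∈ Ioi (0:ℝ), 0 ≤ Ψ ζ)
    (hΨd1 : ∀ ζ ∈ Ioi (0:ℝ), HasDerivAt Ψ (Ψ' ζ) ζ)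
    (hΨd2 : ∀ ζ ∈ Ioi (0:ℝ), HasDerivAt Ψ' (Ψ'' ζ) ζ)
    (hΨ''cont : ContinuousOn Ψ'' (Ioi 0))
    (hΨ'pos : ∀ ζ ∈ Ioi (0:ℝ), 0 < Ψ' ζ)
    (hint : IntegrableOn (fun ζ => 1 / (1 + Ψ ζ)) (Ioi 0))
    (lam : ℝ) (hlam : 0 < lam)
    (hfb : ∀ x ∈ Ioi (0:ℝ), |f x| ≤ M)
    (hfd : ∀ x ∈ Ioi (0:ℝ), HasDerivAt f (f' x) x)
    (hf'cont : ContinuousOn f' (Ioi 0)) :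
    ∃ I : ℝ,
      Tendsto (fun ε : ℝ =>
          ∫ ζ in Ioi (0:ℝ) \ Icc (lam - ε) (lam + ε), f ζ / (Ψ lam - Ψ ζ))
        (𝓝[>] 0) (𝓝 I) ∧
      Tendsto (fun ε : ℝ =>
          ∫ ζ in Ioi (0:ℝ), (f ζ : ℂ) / ((Ψ ζ : ℂ) - (Ψ lam : ℂ) + (ε : ℂ) * Complex.I))
        (𝓝[>] 0)
        (𝓝 (-(I : ℂ) - Complex.I * ((Real.pi : ℂ) * (f lam : ℂ) / (Ψ' lam : ℂ)))) := by
  have hΨc : ContinuousOn Ψ (Ioi 0) := fun x hx => (hΨd1 x hx).continuousAt.continuousWithinAt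
  have hΨ'c : ContinuousOn Ψ' (Ioi 0) := fun x hx => (hΨd2 x hx).continuousAt.continuousWithinAt
  have hfc : ContinuousOn f (Ioi 0) := fun x hx => (hfd x hx).continuousAt.continuousWithinAt
  obtain ⟨a, ha0, hal⟩ : ∃ a, 0 < a ∧ a < lam := ⟨lam / 2, by linarith, by linarith⟩
  obtain ⟨b, hlb⟩ : ∃ b, lam < b := ⟨lam + 1, by linarith⟩
  have hb0 : 0 < b := hlam.trans hlb
  have hIcc : Icc a b ⊆ Ioi 0 := fun x hx => ha0.trans_le hx.1
  have hIoc : Ioc a b ⊆ Ioi 0 := Ioc_subset_Icc_self.trans hIcc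
  set u : ℝ → ℝ := fun x => Ψ x - Ψ lam with hu_def
  have hud : ∀ x ∈ Ioi (0 : ℝ), HasDerivAt u (Ψ' x) x := fun x hx => (hΨd1 x hx).sub_const _
  have huc : ContinuousOn u (Ioi 0) := hΨc.sub continuousOn_const
  have hul : u lam = 0 := sub_self _
  have hune : ∀ x ∈ Ioi (0 : ℝ), x ≠ lam → u x ≠ 0 := fun x hx hxl =>
    sub_ne_zero.2 fun h => hxl (hmono.injOn hx hlam h)
  have hua : u a < 0 := sub_neg.2 (hmono ha0 hlam hal)
  have hub : 0 < u b := sub_pos.2 (hmono hlam hb0 hlb)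
  set h : ℝ := f lam / Ψ' lam with hh
  have hΨ'l : Ψ' lam ≠ 0 := (hΨ'pos lam hlam).ne'
  -- `k` carries the singularity of `f / u` at `lam`.
  set k : ℝ → ℝ := (Ioc a b).indicator fun x => h * Ψ' x with hk
  have hum : AEMeasurable u (volume.restrict (Ioi 0)) := huc.aemeasurable measurableSet_Ioi
  have hkm : AEMeasurable k (volume.restrict (Ioi 0)) :=
    ((continuousOn_const.mul hΨ'c).aemeasurable measurableSet_Ioi).indicator measurableSet_Ioc
  have hgm : AEMeasurable (fun x => f x - k x) (volume.restrict (Ioi 0)) :=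
    (hfc.aemeasurable measurableSet_Ioi).sub hkm
  have hune_ae : ∀ᵐ x ∂(volume.restrict (Ioi 0)), u x ≠ 0 := by
    filter_upwards [ae_restrict_mem measurableSet_Ioi,
      ae_restrict_of_ae (Measure.ae_ne volume lam)] with x hx hxl
    exact hune x hx hxl
  have hG : IntegrableOn (fun x => (f x - k x) / u x) (Ioi 0) := by
    rw [← union_sdiff_cancel hIoc]
    refine IntegrableOn.union ?_ ?_
    · have hnear : IntegrableOn (fun x => (f x - h * Ψ' x) / u x) (Icc a b) :=
        integrableOn_div_Icc_of_zero ⟨hal, hlb⟩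
          ((hfc.mono hIcc).sub (continuousOn_const.mul (hΨ'c.mono hIcc)))
          ((hfd lam hlam).differentiableAt.sub
            ((hΨd2 lam hlam).differentiableAt.const_mul h))
          (by rw [hh]; field_simp; ring) (huc.mono hIcc) (hud lam hlam) hul hΨ'l
          fun x hx => hune x (hIcc hx)
      refine (hnear.mono_set Ioc_subset_Icc_self).congr_fun (fun x hx => ?_) measurableSet_Ioc
      simp only [hk, indicator_of_mem hx]
    · have hsub : Ioi 0 \ Ioc a b ⊆ Ioi (0 : ℝ) := sdiff_subset
      have hms : MeasurableSet (Ioi 0 \ Ioc a b) := measurableSet_Ioi.diff measurableSet_Ioc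
      have hfar : IntegrableOn (fun x => f x / (Ψ x - Ψ lam)) (Ioi 0 \ Ioc a b) := by
        refine integrableOn_div_sub_of_le_abs (δ := min (-u a) (u b)) (M := M) hms
          (hΨc.mono hsub) (hfc.mono hsub)
          (fun x hx => hnonneg x (hsub hx)) (hnonneg lam hlam) (hint.mono_set hsub)
          (fun x hx => hfb x (hsub hx)) (lt_min (neg_pos.2 hua) hub) fun x hx => ?_
        rcases le_or_gt x a with hxa | hxa
        · refine (min_le_left _ _).trans (le_trans ?_ (neg_le_abs _))
          have := hmono.monotoneOn (hsub hx) ha0 hxa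
          simp only [hu_def]; linarith
        · have hxb : b ≤ x := le_of_not_ge fun h' => hx.2 ⟨hxa, h'⟩
          refine (min_le_right _ _).trans (le_trans ?_ (le_abs_self _))
          have := hmono.monotoneOn hb0 (hsub hx) hxb
          simp only [hu_def]; linarith
      refine hfar.congr_fun (fun x hx => ?_) hms
      simp only [hk, indicator_of_notMem hx.2, sub_zero, hu_def]
  set L : ℝ := Real.log (u b) - Real.log (u a) with hL
  refine ⟨-((∫ x in Ioi 0, (f x - k x) / u x) + h * L), ?_, ?_⟩
  · have hpv := tendsto_integral_deriv_div_Ioc_diff_Icc ⟨hal, hlb⟩ (fun x hx => hud x (hIcc hx))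
      (hΨ'c.mono hIcc) (fun x hx => hune x (hIcc hx)) hul (hΨ'pos lam hlam)
    refine ((tendsto_setIntegral_diff_Icc hG lam).add (hpv.const_mul h)).neg.congr' ?_
    filter_upwards [self_mem_nhdsWithin,
      nhdsWithin_le_nhds (Iio_mem_nhds (sub_pos.2 hal)),
      nhdsWithin_le_nhds (Iio_mem_nhds (sub_pos.2 hlb))] with ε hε h1 h2
    have hk_eq : (fun x => k x / u x) = (Ioc a b).indicator fun x => h * (Ψ' x / u x) := by
      ext x
      by_cases hx : x ∈ Ioc a b <;> simp [hk, hx, mul_div_assoc]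
    have hinter : (Ioi 0 \ Icc (lam - ε) (lam + ε)) ∩ Ioc a b =
        Ioc a b \ Icc (lam - ε) (lam + ε) := by
      ext x
      exact ⟨fun hx => ⟨hx.2, hx.1.2⟩, fun hx => ⟨⟨hIoc hx.1, hx.2⟩, hx.1⟩⟩
    have hki : IntegrableOn (fun x => k x / u x) (Ioi 0 \ Icc (lam - ε) (lam + ε)) := by
      rw [hk_eq, IntegrableOn, integrable_indicator_iff measurableSet_Ioc, IntegrableOn,
        Measure.restrict_restrict measurableSet_Ioc, inter_comm, hinter]
      refine Integrable.const_mul ?_ h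
      exact integrableOn_deriv_div_Ioc_diff_Icc (huc.mono hIcc) (hΨ'c.mono hIcc)
        (fun x hx => hune x (hIcc hx)) hε (by have := mem_Iio.1 h1; linarith)
        (by have := mem_Iio.1 h2; linarith)
    have hkint : ∫ x in Ioi 0 \ Icc (lam - ε) (lam + ε), k x / u x =
        h * ∫ x in Ioc a b \ Icc (lam - ε) (lam + ε), Ψ' x / u x := by
      rw [hk_eq, setIntegral_indicator measurableSet_Ioc, hinter, integral_const_mul]
    rw [← hkint, ← integral_add (hG.mono_set sdiff_subset) hki, ← integral_neg]
    congr 1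
    ext x
    rw [← add_div, sub_add_cancel, ← neg_sub (Ψ x) (Ψ lam), div_neg]
  · have hlog := tendsto_integral_deriv_div_add_mul_I (hal.trans hlb).le
      (fun x hx => hud x (hIcc hx)) (hΨ'c.mono hIcc) hua hub
    have hlim := (tendsto_integral_div_add_mul_I hgm hum hune_ae hG).add (hlog.const_mul (h : ℂ))
    have heq : ((∫ x in Ioi 0, (f x - k x) / u x : ℝ) : ℂ) +
        (h : ℂ) * ((L : ℝ) - (Real.pi : ℂ) * Complex.I) =
        -((-((∫ x in Ioi 0, (f x - k x) / u x) + h * L) : ℝ) : ℂ) -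
          Complex.I * ((Real.pi : ℂ) * (f lam : ℂ) / (Ψ' lam : ℂ)) := by
      rw [hh]; push_cast; ring
    rw [← heq]
    refine hlim.congr' ?_
    filter_upwards [self_mem_nhdsWithin] with ε hε
    have hk_eq : (fun x => (k x : ℂ) / ((u x : ℂ) + (ε : ℂ) * Complex.I)) =
        (Ioc a b).indicator fun x =>
          (h : ℂ) * ((Ψ' x : ℂ) / ((u x : ℂ) + (ε : ℂ) * Complex.I)) := by
      ext x
      by_cases hx : x ∈ Ioc a b <;> simp [hk, hx, mul_div_assoc]
    have hki : IntegrableOn (fun x => (k x : ℂ) / ((u x : ℂ) + (ε : ℂ) * Complex.I)) (Ioi 0) := by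
      rw [hk_eq]
      refine Integrable.integrableOn ((integrable_indicator_iff measurableSet_Ioc).2 ?_)
      refine IntegrableOn.mono_set (ContinuousOn.integrableOn_Icc ?_) Ioc_subset_Icc_self
      have h1 := huc.mono hIcc
      have h2 := hΨ'c.mono hIcc
      refine continuousOn_const.mul (ContinuousOn.div (by fun_prop) (by fun_prop) fun x _ => ?_)
      exact Complex.slitPlane_ne_zero (Or.inr (by simpa using (mem_Ioi.1 hε).ne'))
    have hkint : ∫ x in Ioi 0, (k x : ℂ) / ((u x : ℂ) + (ε : ℂ) * Complex.I) =
        h * ∫ x in a..b, (Ψ' x : ℂ) / ((u x : ℂ) + (ε : ℂ) * Complex.I) := by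
      rw [hk_eq, setIntegral_indicator measurableSet_Ioc, inter_eq_right.2 hIoc,
        integral_const_mul, intervalIntegral.integral_of_le (hal.trans hlb).le]
    rw [← hkint, ← integral_add (integrable_div_add_mul_I hgm hum hune_ae hG ε) hki]
    congr 1
    ext x
    rw [← add_div, Complex.ofReal_sub, sub_add_cancel, hu_def, Complex.ofReal_sub]
end

section
/- Assume Ψ : (0,∞) → [0,∞) is strictly increasing, twice continuously differentiable with Ψ'(ζ) > 0 for all ζ > 0, and ∫₀^∞ 1/(1+Ψ(ζ)) dζ < ∞. Then for every λ > 0 and ξ > 0, the principal values defining K_λ and K_λ(ξ) exist, and lim_{ε→0⁺} φ(−Ψ(λ)+iε) = (K_λ − i)/Ψ'(λ) and lim_{ε→0⁺} φ(ξ, −Ψ(λ)+iε) = (K_λ(ξ) − i·L_λ(ξ))/Ψ'(λ). -/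
open MeasureTheory Filter Topology Set

/-- The regularised Cauchy integrand at height `ε`: near `lam` the linearised pole is subtracted. -/
noncomputable def regularizedKernel (Ψ w : ℝ → ℝ) (a lam ε ζ : ℝ) : ℂ :=
  (w ζ : ℂ) * (((Ψ ζ - Ψ lam : ℝ) : ℂ) + ε * Complex.I)⁻¹ -
    (Icc (lam - lam / 2) (lam + lam / 2)).indicator
      (fun ζ => (w lam : ℂ) * (((a * (ζ - lam) : ℝ) : ℂ) + ε * Complex.I)⁻¹) ζ

/-- The real regularised integrand, the value of `regularizedKernel` at height `0`. -/
noncomputable def regularizedRealKernel (Ψ w : ℝ → ℝ) (a lam ζ : ℝ) : ℝ :=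
  w ζ * (Ψ ζ - Ψ lam)⁻¹ -
    (Icc (lam - lam / 2) (lam + lam / 2)).indicator
      (fun ζ => w lam * (a * (ζ - lam))⁻¹) ζ

lemma regularizedKernel_zero (Ψ w : ℝ → ℝ) (a lam ζ : ℝ) :
    regularizedKernel Ψ w a lam 0 ζ = (regularizedRealKernel Ψ w a lam ζ : ℂ) := by
  unfold regularizedKernel regularizedRealKernel
  by_cases h : ζ ∈ Icc (lam - lam / 2) (lam + lam / 2) <;> simp [h]

lemma abs_le_norm_ofReal_add_mul_I (x ε : ℝ) : |x| ≤ ‖(x : ℂ) + ε * Complex.I‖ := by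
  simpa using Complex.abs_re_le_norm ((x : ℂ) + ε * Complex.I)

lemma norm_mul_inv_sub_mul_inv_le {w w₀ g t a m L C ε : ℝ} (hm : 0 < m) (ha : 0 < a)
    (ht : t ≠ 0) (hw₀ : |w₀| ≤ 1) (hw : |w - w₀| ≤ L * |t|) (hg : m * |t| ≤ |g|)
    (hC : |a * t - g| ≤ C * t ^ 2) :
    ‖(w : ℂ) * ((g : ℂ) + ε * Complex.I)⁻¹ -
      (w₀ : ℂ) * (((a * t : ℝ) : ℂ) + ε * Complex.I)⁻¹‖ ≤ L / m + C / (m * a) := by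
  have ht' : 0 < |t| := abs_pos.mpr ht
  have hG := hg.trans (abs_le_norm_ofReal_add_mul_I g ε)
  have hA := abs_le_norm_ofReal_add_mul_I (a * t) ε
  rw [abs_mul, abs_of_pos ha] at hA
  set G := (g : ℂ) + ε * Complex.I with hGdef
  set A := ((a * t : ℝ) : ℂ) + ε * Complex.I with hAdef
  have hG0 : 0 < ‖G‖ := lt_of_lt_of_le (by positivity) hG
  have hA0 : 0 < ‖A‖ := lt_of_lt_of_le (by positivity) hA
  have hGn : G ≠ 0 := norm_pos_iff.mp hG0
  have hAn : A ≠ 0 := norm_pos_iff.mp hA0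
  have hAG : A - G = ((a * t - g : ℝ) : ℂ) := by rw [hGdef, hAdef]; push_cast; ring
  have key : (w : ℂ) * G⁻¹ - (w₀ : ℂ) * A⁻¹ =
      ((w - w₀ : ℝ) : ℂ) / G + (w₀ : ℂ) * ((a * t - g : ℝ) : ℂ) / (G * A) := by
    rw [← hAG]; push_cast; field_simp; ring
  rw [key]
  refine (norm_add_le _ _).trans (add_le_add ?_ ?_)
  · rw [norm_div, Complex.norm_real, Real.norm_eq_abs, div_le_div_iff₀ hG0 hm]
    have hL : 0 ≤ L := by
      have := (abs_nonneg _).trans hw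
      exact nonneg_of_mul_nonneg_left this ht'
    calc |w - w₀| * m ≤ L * |t| * m := by gcongr
      _ = L * (m * |t|) := by ring
      _ ≤ L * ‖G‖ := by gcongr
  · rw [norm_div, norm_mul, norm_mul, Complex.norm_real, Complex.norm_real, Real.norm_eq_abs,
      Real.norm_eq_abs, div_le_div_iff₀ (by positivity) (by positivity)]
    have hC0 : 0 ≤ C := by
      have := (abs_nonneg _).trans hC
      exact nonneg_of_mul_nonneg_left this (by positivity)
    calc |w₀| * |a * t - g| * (m * a) ≤ 1 * (C * t ^ 2) * (m * a) := by gcongr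
      _ = C * ((m * |t|) * (a * |t|)) := by rw [← sq_abs t]; ring
      _ ≤ C * (‖G‖ * ‖A‖) := by gcongr

/-- A mean value point lying between `x` and `y`. -/
lemma exists_hasDerivAt_sub_eq_mul {f f' : ℝ → ℝ} {s : Set ℝ} (hs : s.OrdConnected)
    (hf : ∀ z ∈ s, HasDerivAt f (f' z) z) {x y : ℝ} (hx : x ∈ s) (hy : y ∈ s) :
    ∃ c ∈ s, |c - x| ≤ |y - x| ∧ f y - f x = f' c * (y - x) := by
  rcases lt_trichotomy x y with h | h | h
  · have hsub : Icc x y ⊆ s := hs.out hx hy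
    obtain ⟨c, hc, he⟩ := exists_hasDerivAt_eq_slope f f' h
      (fun z hz => (hf z (hsub hz)).continuousAt.continuousWithinAt)
      (fun z hz => hf z (hsub (Ioo_subset_Icc_self hz)))
    refine ⟨c, hsub (Ioo_subset_Icc_self hc), ?_, ?_⟩
    · rw [abs_of_pos (sub_pos.2 hc.1), abs_of_pos (sub_pos.2 h)]; linarith [hc.2]
    · rw [he]; field_simp [(sub_pos.2 h).ne']
  · subst h; exact ⟨x, hx, by simp, by simp⟩
  · have hsub : Icc y x ⊆ s := hs.out hy hx
    obtain ⟨c, hc, he⟩ := exists_hasDerivAt_eq_slope f f' h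
      (fun z hz => (hf z (hsub hz)).continuousAt.continuousWithinAt)
      (fun z hz => hf z (hsub (Ioo_subset_Icc_self hz)))
    refine ⟨c, hsub (Ioo_subset_Icc_self hc), ?_, ?_⟩
    · rw [abs_of_neg (sub_neg.2 hc.2), abs_of_neg (sub_neg.2 h)]; linarith [hc.1]
    · have : x - y ≠ 0 := (sub_pos.2 h).ne'
      rw [he]; field_simp; ring

lemma exists_norm_regularizedKernel_le {Ψ Ψ' Ψ'' w : ℝ → ℝ}
    (hmono : StrictMonoOn Ψ (Ioi 0))
    (hnonneg : ∀ ζ ∈ Ioi (0:ℝ), 0 ≤ Ψ ζ)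
    (hΨd1 : ∀ ζ ∈ Ioi (0:ℝ), HasDerivAt Ψ (Ψ' ζ) ζ)
    (hΨd2 : ∀ ζ ∈ Ioi (0:ℝ), HasDerivAt Ψ' (Ψ'' ζ) ζ)
    (hΨ''cont : ContinuousOn Ψ'' (Ioi 0))
    (hΨ'pos : ∀ ζ ∈ Ioi (0:ℝ), 0 < Ψ' ζ)
    {lam L : ℝ} (hlam : 0 < lam) (hw1 : ∀ ζ, |w ζ| ≤ 1)
    (hwL : ∀ ζ ∈ Icc (lam - lam / 2) (lam + lam / 2), |w ζ - w lam| ≤ L * |ζ - lam|) :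
    ∃ C, ∀ ε, ∀ ζ ∈ Ioi (0:ℝ), ζ ≠ lam →
      ‖regularizedKernel Ψ w (Ψ' lam) lam ε ζ‖ ≤ C * (1 / (1 + Ψ ζ)) := by
  set N := Icc (lam - lam / 2) (lam + lam / 2) with hN
  have hNpos : N ⊆ Ioi 0 := fun x hx => by
    have := hx.1; simp only [mem_Ioi]; linarith
  have hlamN : lam ∈ N := ⟨by linarith, by linarith⟩
  have hNord : N.OrdConnected := ordConnected_Icc
  have ha := hΨ'pos lam hlam
  have hΨ'c : ContinuousOn Ψ' N := fun z hz =>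
    (hΨd2 z (hNpos hz)).continuousAt.continuousWithinAt
  obtain ⟨c₀, hc₀, hmin⟩ := isCompact_Icc.exists_isMinOn ⟨lam, hlamN⟩ hΨ'c
  have hm : 0 < Ψ' c₀ := hΨ'pos _ (hNpos hc₀)
  obtain ⟨C, hC⟩ := isCompact_Icc.exists_bound_of_continuousOn (hΨ''cont.mono hNpos)
  have hC0 : 0 ≤ C := (norm_nonneg _).trans (hC lam hlamN)
  have hL0 : 0 ≤ L := by
    have h := (abs_nonneg _).trans (hwL (lam + lam / 2) ⟨by linarith, le_rfl⟩)
    refine nonneg_of_mul_nonneg_left h (abs_pos.mpr ?_)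
    linarith
  set M := L / Ψ' c₀ + C / (Ψ' c₀ * Ψ' lam) with hM
  have hM0 : 0 ≤ M := by positivity
  have hr : lam + lam / 2 ∈ Ioi (0:ℝ) := by simp only [mem_Ioi]; linarith
  have hl : lam - lam / 2 ∈ Ioi (0:ℝ) := by simp only [mem_Ioi]; linarith
  have hp : 0 < Ψ (lam + lam / 2) - Ψ lam := sub_pos.2 (hmono hlam hr (by linarith))
  have hq : 0 < Ψ lam - Ψ (lam - lam / 2) := sub_pos.2 (hmono hl hlam (by linarith))
  have hΨr := hnonneg _ hr
  have hΨlam := hnonneg _ hlam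
  set C₁ := M * (1 + Ψ (lam + lam / 2)) with hC₁
  set C₂ := (1 + Ψ (lam + lam / 2)) / (Ψ (lam + lam / 2) - Ψ lam) with hC₂
  set C₃ := (1 + Ψ lam) / (Ψ lam - Ψ (lam - lam / 2)) with hC₃
  have h1 : 0 ≤ C₁ := by positivity
  have h2 : 0 ≤ C₂ := by positivity
  have h3 : 0 ≤ C₃ := by positivity
  refine ⟨C₁ + C₂ + C₃, fun ε ζ hζ hne => ?_⟩
  have hΨζ := hnonneg _ hζ
  have hden : 0 < 1 + Ψ ζ := by linarith
  rw [mul_one_div, le_div_iff₀ hden]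
  by_cases hζN : ζ ∈ N
  · have hb : ‖regularizedKernel Ψ w (Ψ' lam) lam ε ζ‖ ≤ M := by
      unfold regularizedKernel
      rw [indicator_of_mem hζN]
      obtain ⟨c, hcN, hcle, hce⟩ := exists_hasDerivAt_sub_eq_mul hNord
        (fun z hz => hΨd1 z (hNpos hz)) hlamN hζN
      obtain ⟨d, hdN, -, hde⟩ := exists_hasDerivAt_sub_eq_mul hNord
        (fun z hz => hΨd2 z (hNpos hz)) hlamN hcN
      refine norm_mul_inv_sub_mul_inv_le hm ha (sub_ne_zero.2 hne) (hw1 _) (hwL _ hζN) ?_ ?_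
      · rw [hce, abs_mul, abs_of_pos (hΨ'pos _ (hNpos hcN))]
        gcongr
        exact hmin hcN
      · have : Ψ' lam * (ζ - lam) - (Ψ ζ - Ψ lam) = -(Ψ'' d * (c - lam) * (ζ - lam)) := by
          rw [hce, ← hde]; ring
        rw [this, abs_neg, abs_mul, abs_mul, ← sq_abs (ζ - lam), sq, ← mul_assoc]
        gcongr
        exact hC d hdN
    have hle : Ψ ζ ≤ Ψ (lam + lam / 2) := hmono.monotoneOn hζ hr hζN.2
    calc _ ≤ M * (1 + Ψ (lam + lam / 2)) := by gcongr
      _ ≤ _ := by linarith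
  · have hb : ‖regularizedKernel Ψ w (Ψ' lam) lam ε ζ‖ ≤ |Ψ ζ - Ψ lam|⁻¹ := by
      unfold regularizedKernel
      rw [indicator_of_notMem hζN, sub_zero, norm_mul, norm_inv, Complex.norm_real,
        Real.norm_eq_abs]
      have hpos : 0 < |Ψ ζ - Ψ lam| :=
        abs_pos.2 (sub_ne_zero.2 fun h => hne (hmono.injOn hζ hlam h))
      have := inv_anti₀ hpos (abs_le_norm_ofReal_add_mul_I (Ψ ζ - Ψ lam) ε)
      calc _ ≤ 1 * |Ψ ζ - Ψ lam|⁻¹ := by gcongr; exact hw1 ζ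
        _ = _ := one_mul _
    refine (mul_le_mul_of_nonneg_right hb hden.le).trans ?_
    rcases lt_or_ge ζ lam with hlt | hge
    · have hζl : ζ < lam - lam / 2 := by
        by_contra! h
        exact hζN ⟨h, by linarith⟩
      have hΨl := hmono hζ hl hζl
      have hstep : |Ψ ζ - Ψ lam|⁻¹ * (1 + Ψ ζ) ≤ C₃ := by
        rw [abs_sub_comm, abs_of_pos (by linarith), inv_mul_eq_div]
        exact div_le_div₀ (by linarith) (by linarith) hq (by linarith)
      linarith
    · have hζr : lam + lam / 2 < ζ := by
        by_contra! h
        exact hζN ⟨by linarith, h⟩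
      have hΨl := hmono hr hζ hζr
      have hstep : |Ψ ζ - Ψ lam|⁻¹ * (1 + Ψ ζ) ≤ C₂ := by
        rw [abs_of_pos (by linarith), inv_mul_eq_div, div_le_div_iff₀ (by linarith) hp]
        nlinarith
      linarith

lemma aestronglyMeasurable_regularizedKernel {Ψ w : ℝ → ℝ} {μ : Measure ℝ}
    (hΨ : AEMeasurable Ψ μ) (hw : Measurable w) (a lam ε : ℝ) :
    AEStronglyMeasurable (regularizedKernel Ψ w a lam ε) μ := by
  refine AEMeasurable.aestronglyMeasurable (AEMeasurable.sub ?_ (Measurable.aemeasurable ?_))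
  · have h1 : AEMeasurable (fun ζ => ((Ψ ζ - Ψ lam : ℝ) : ℂ)) μ :=
      Complex.measurable_ofReal.comp_aemeasurable (hΨ.sub_const _)
    exact (Complex.measurable_ofReal.comp hw).aemeasurable.mul (h1.add_const _).inv
  · exact Measurable.indicator (by fun_prop) measurableSet_Icc

/-- The Cauchy integral of a simple real pole over a symmetric interval, approached from above. -/
lemma tendsto_integral_inv_linear_add_mul_I {a lam δ : ℝ} (ha : 0 < a) (hδ : 0 < δ) :
    Tendsto (fun ε : ℝ => ∫ ζ in Icc (lam - δ) (lam + δ),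
        (((a * (ζ - lam) : ℝ) : ℂ) + ε * Complex.I)⁻¹)
      (𝓝[>] 0) (𝓝 (-(Complex.I * Real.pi) / a)) := by
  have hac : (a : ℂ) ≠ 0 := by exact_mod_cast ha.ne'
  have hval : ∀ ε : ℝ, 0 < ε → ∫ ζ in Icc (lam - δ) (lam + δ),
      (((a * (ζ - lam) : ℝ) : ℂ) + ε * Complex.I)⁻¹ =
      (Complex.log (((a * δ : ℝ) : ℂ) + ε * Complex.I) -
        Complex.log (((-(a * δ) : ℝ) : ℂ) + ε * Complex.I)) / a := by
    intro ε hε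
    have him : ∀ x : ℝ, ((x : ℂ) + ε * Complex.I).im = ε := by intro x; simp
    have hslit : ∀ x : ℝ, ((x : ℂ) + ε * Complex.I) ∈ Complex.slitPlane := fun x =>
      Or.inr (by rw [him]; exact hε.ne')
    rw [integral_Icc_eq_integral_Ioc, ← intervalIntegral.integral_of_le (by linarith)]
    rw [intervalIntegral.integral_eq_sub_of_hasDerivAt
      (f := fun ζ : ℝ => Complex.log (((a * (ζ - lam) : ℝ) : ℂ) + ε * Complex.I) / a)]
    · rw [← sub_div]
      congr 5 <;> ring
    · intro ζ _
      have h0 : HasDerivAt (fun ζ : ℝ => (((a * (ζ - lam) : ℝ) : ℂ) + ε * Complex.I))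
          (a : ℂ) ζ := by
        have : HasDerivAt (fun ζ : ℝ => a * (ζ - lam)) a ζ := by
          simpa using ((hasDerivAt_id ζ).sub_const lam).const_mul a
        exact this.ofReal_comp.add_const _
      refine ((h0.clog_real (hslit _)).div_const (a : ℂ)).congr_deriv ?_
      rw [div_right_comm, div_self hac, one_div]
    · refine ContinuousOn.intervalIntegrable (Continuous.continuousOn ?_)
      refine Continuous.inv₀ (by fun_prop) fun x => Complex.slitPlane_ne_zero (hslit _)
  have hlin : ∀ x : ℝ, Tendsto (fun ε : ℝ => (x : ℂ) + ε * Complex.I) (𝓝[>] 0) (𝓝 (x : ℂ)) := by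
    intro x
    have : Continuous fun ε : ℝ => (x : ℂ) + ε * Complex.I := by fun_prop
    simpa using (this.tendsto 0).mono_left nhdsWithin_le_nhds
  have haδ : 0 < a * δ := mul_pos ha hδ
  have hright : Tendsto (fun ε : ℝ => Complex.log (((a * δ : ℝ) : ℂ) + ε * Complex.I)) (𝓝[>] 0)
      (𝓝 (Complex.log ((a * δ : ℝ) : ℂ))) :=
    (hlin _).clog (Complex.ofReal_mem_slitPlane.2 haδ)
  have hleft : Tendsto (fun ε : ℝ => Complex.log (((-(a * δ) : ℝ) : ℂ) + ε * Complex.I)) (𝓝[>] 0)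
      (𝓝 (Complex.log ((-(a * δ) : ℝ) : ℂ))) := by
    have hc := Complex.continuousWithinAt_log_of_re_neg_of_im_zero
      (z := ((-(a * δ) : ℝ) : ℂ)) (by rw [Complex.ofReal_re]; linarith) (Complex.ofReal_im _)
    refine Tendsto.comp hc (tendsto_nhdsWithin_iff.2 ⟨hlin _, ?_⟩)
    filter_upwards [self_mem_nhdsWithin] with ε hε
    simpa using (le_of_lt hε : (0:ℝ) ≤ ε)
  have hlim := (hright.sub hleft).div_const (a : ℂ)
  have hE : (Complex.log ((a * δ : ℝ) : ℂ) - Complex.log ((-(a * δ) : ℝ) : ℂ)) / a =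
      -(Complex.I * Real.pi) / a := by
    congr 1
    rw [← Complex.ofReal_log haδ.le, Complex.log, Complex.arg_ofReal_of_neg (by linarith),
      Complex.norm_real, Real.norm_eq_abs, abs_neg, abs_of_pos haδ]
    ring
  rw [hE] at hlim
  refine hlim.congr' ?_
  filter_upwards [self_mem_nhdsWithin] with ε hε
  exact (hval ε hε).symm

lemma integral_symm_diff_inv_eq_zero (c a lam δ ε : ℝ) :
    ∫ ζ in Icc (lam - δ) (lam + δ) \ Icc (lam - ε) (lam + ε), c * (a * (ζ - lam))⁻¹ = 0 := by
  have hms : MeasurableSet (Icc (lam - δ) (lam + δ) \ Icc (lam - ε) (lam + ε)) :=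
    measurableSet_Icc.diff measurableSet_Icc
  rw [← integral_indicator hms]
  set f := (Icc (lam - δ) (lam + δ) \ Icc (lam - ε) (lam + ε)).indicator
    (fun ζ => c * (a * (ζ - lam))⁻¹) with hf
  have hodd : ∀ x, f (2 * lam - x) = -f x := by
    intro x
    have hiff : 2 * lam - x ∈ Icc (lam - δ) (lam + δ) \ Icc (lam - ε) (lam + ε) ↔
        x ∈ Icc (lam - δ) (lam + δ) \ Icc (lam - ε) (lam + ε) := by
      simp only [Set.mem_sdiff, mem_Icc]
      constructor <;> rintro ⟨⟨h1, h2⟩, h3⟩ <;>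
        exact ⟨⟨by linarith, by linarith⟩, fun h => h3 ⟨by linarith [h.2], by linarith [h.1]⟩⟩
    by_cases hx : x ∈ Icc (lam - δ) (lam + δ) \ Icc (lam - ε) (lam + ε)
    · rw [hf, indicator_of_mem hx, indicator_of_mem (hiff.2 hx),
        show a * (2 * lam - x - lam) = -(a * (x - lam)) by ring, inv_neg, mul_neg]
    · rw [hf, indicator_of_notMem hx, indicator_of_notMem (fun h => hx (hiff.1 h)), neg_zero]
  have h := integral_sub_left_eq_self f volume (2 * lam)
  simp_rw [hodd, integral_neg] at h
  linarith

/-- A weighted Sokhotski–Plemelj formula along the graph of `Ψ`. -/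
lemma exists_principalValue_and_tendsto_cauchyIntegral {Ψ Ψ' Ψ'' w : ℝ → ℝ}
    (hmono : StrictMonoOn Ψ (Ioi 0))
    (hnonneg : ∀ ζ ∈ Ioi (0:ℝ), 0 ≤ Ψ ζ)
    (hΨd1 : ∀ ζ ∈ Ioi (0:ℝ), HasDerivAt Ψ (Ψ' ζ) ζ)
    (hΨd2 : ∀ ζ ∈ Ioi (0:ℝ), HasDerivAt Ψ' (Ψ'' ζ) ζ)
    (hΨ''cont : ContinuousOn Ψ'' (Ioi 0))
    (hΨ'pos : ∀ ζ ∈ Ioi (0:ℝ), 0 < Ψ' ζ)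
    (hint : IntegrableOn (fun ζ => 1 / (1 + Ψ ζ)) (Ioi 0))
    {lam L : ℝ} (hlam : 0 < lam) (hwm : Measurable w) (hw1 : ∀ ζ, |w ζ| ≤ 1)
    (hwL : ∀ ζ ∈ Icc (lam - lam / 2) (lam + lam / 2), |w ζ - w lam| ≤ L * |ζ - lam|) :
    ∃ J : ℝ,
      Tendsto (fun ε : ℝ => ∫ ζ in Ioi (0:ℝ) \ Icc (lam - ε) (lam + ε),
          w ζ * (Ψ ζ - Ψ lam)⁻¹) (𝓝[>] 0) (𝓝 J) ∧
      Tendsto (fun ε : ℝ => ∫ ζ in Ioi (0:ℝ),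
          (w ζ : ℂ) * (((Ψ ζ - Ψ lam : ℝ) : ℂ) + ε * Complex.I)⁻¹) (𝓝[>] 0)
        (𝓝 (J + w lam * (-(Complex.I * Real.pi) / Ψ' lam))) := by
  obtain ⟨C, hC⟩ := exists_norm_regularizedKernel_le hmono hnonneg hΨd1 hΨd2 hΨ''cont hΨ'pos
    hlam hw1 hwL
  have ha := hΨ'pos lam hlam
  set a := Ψ' lam
  set N := Icc (lam - lam / 2) (lam + lam / 2) with hN
  have hNpos : N ⊆ Ioi 0 := fun x hx => by
    have := hx.1; simp only [mem_Ioi]; linarith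
  have hΨm : AEMeasurable Ψ (volume.restrict (Ioi 0)) :=
    ContinuousOn.aemeasurable (fun z hz => (hΨd1 z hz).continuousAt.continuousWithinAt)
      measurableSet_Ioi
  have hB : Integrable (fun ζ => C * (1 / (1 + Ψ ζ))) (volume.restrict (Ioi 0)) :=
    hint.const_mul C
  have hne : ∀ᵐ ζ ∂(volume.restrict (Ioi (0:ℝ))), ζ ≠ lam :=
    ae_restrict_of_ae (by simp [ae_iff])
  have hbound : ∀ ε, ∀ᵐ ζ ∂(volume.restrict (Ioi (0:ℝ))),
      ‖regularizedKernel Ψ w a lam ε ζ‖ ≤ C * (1 / (1 + Ψ ζ)) := fun ε => by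
    filter_upwards [hne, ae_restrict_mem measurableSet_Ioi] with ζ h1 h2 using hC ε ζ h2 h1
  have hKint : ∀ ε, IntegrableOn (regularizedKernel Ψ w a lam ε) (Ioi 0) := fun ε =>
    hB.mono' (aestronglyMeasurable_regularizedKernel hΨm hwm a lam ε) (hbound ε)
  have hnormR : ∀ ζ, ‖regularizedRealKernel Ψ w a lam ζ‖ = ‖regularizedKernel Ψ w a lam 0 ζ‖ :=
    fun ζ => by rw [regularizedKernel_zero, Complex.norm_real]
  have hRint : IntegrableOn (regularizedRealKernel Ψ w a lam) (Ioi 0) := by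
    have := (hKint 0).re
    refine this.congr (ae_of_all _ fun ζ => ?_)
    simp [regularizedKernel_zero]
  refine ⟨∫ ζ in Ioi (0:ℝ), regularizedRealKernel Ψ w a lam ζ, ?_, ?_⟩
  · have hlim : Tendsto (fun ε : ℝ => ∫ ζ in Ioi (0:ℝ),
        ((Icc (lam - ε) (lam + ε))ᶜ).indicator (regularizedRealKernel Ψ w a lam) ζ) (𝓝[>] 0)
        (𝓝 (∫ ζ in Ioi (0:ℝ), regularizedRealKernel Ψ w a lam ζ)) := by
      refine tendsto_integral_filter_of_dominated_convergence (fun ζ => C * (1 / (1 + Ψ ζ)))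
        ?_ ?_ hB ?_
      · exact Eventually.of_forall fun ε =>
          hRint.aestronglyMeasurable.indicator measurableSet_Icc.compl
      · refine Eventually.of_forall fun ε => ?_
        filter_upwards [hbound 0] with ζ hζ
        exact (norm_indicator_le_norm_self _ _).trans ((hnormR ζ).le.trans hζ)
      · filter_upwards [hne] with ζ hζ
        refine tendsto_const_nhds.congr' ?_
        have hpos : 0 < |ζ - lam| := abs_pos.2 (sub_ne_zero.2 hζ)
        filter_upwards [Ioo_mem_nhdsGT hpos] with ε hε
        rw [indicator_of_mem]
        intro hmem
        have : |ζ - lam| ≤ ε := abs_le.2 ⟨by linarith [hmem.1], by linarith [hmem.2]⟩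
        exact absurd hε.2 (not_lt.2 this)
    refine hlim.congr' ?_
    filter_upwards [self_mem_nhdsWithin] with ε hε
    have hε0 : 0 < ε := hε
    rw [setIntegral_indicator measurableSet_Icc.compl, ← sdiff_eq]
    have hms : MeasurableSet (Ioi (0:ℝ) \ Icc (lam - ε) (lam + ε)) :=
      measurableSet_Ioi.diff measurableSet_Icc
    have hset : (Ioi (0:ℝ) \ Icc (lam - ε) (lam + ε)) ∩ N = N \ Icc (lam - ε) (lam + ε) := by
      ext x
      simp only [mem_inter_iff, Set.mem_sdiff]
      exact ⟨fun h => ⟨h.2, h.1.2⟩, fun h => ⟨⟨hNpos h.1, h.2⟩, h.1⟩⟩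
    have hpole : IntegrableOn (N.indicator fun ζ => w lam * (a * (ζ - lam))⁻¹)
        (Ioi (0:ℝ) \ Icc (lam - ε) (lam + ε)) := by
      rw [IntegrableOn, integrable_indicator_iff measurableSet_Icc, IntegrableOn,
        Measure.restrict_restrict measurableSet_Icc, inter_comm, hset]
      refine Measure.integrableOn_of_bounded (M := 1 * (a * ε)⁻¹)
        ((measure_mono sdiff_subset).trans_lt measure_Icc_lt_top).ne
        (Measurable.aestronglyMeasurable (by fun_prop)) ?_
      filter_upwards [ae_restrict_mem (measurableSet_Icc.diff measurableSet_Icc)] with ζ hζ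
      have hfar : ε ≤ |ζ - lam| := by
        by_contra! h
        have := abs_lt.1 h
        exact hζ.2 ⟨by linarith, by linarith⟩
      rw [norm_mul, norm_inv, norm_mul, Real.norm_eq_abs, Real.norm_eq_abs, Real.norm_eq_abs,
        abs_of_pos ha]
      gcongr
      exact hw1 lam
    have hsum := integral_add (hRint.mono_set sdiff_subset) hpole
    rw [setIntegral_indicator measurableSet_Icc, hset, integral_symm_diff_inv_eq_zero,
      add_zero] at hsum
    rw [← hsum]
    refine integral_congr_ae (ae_of_all _ fun ζ => ?_)
    simp only [regularizedRealKernel, ← hN, sub_add_cancel]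
  · have hlim : Tendsto (fun ε : ℝ => ∫ ζ in Ioi (0:ℝ), regularizedKernel Ψ w a lam ε ζ) (𝓝[>] 0)
        (𝓝 (∫ ζ in Ioi (0:ℝ), regularizedKernel Ψ w a lam 0 ζ)) := by
      refine tendsto_integral_filter_of_dominated_convergence (fun ζ => C * (1 / (1 + Ψ ζ)))
        (Eventually.of_forall fun ε => (hKint ε).aestronglyMeasurable)
        (Eventually.of_forall hbound) hB ?_
      filter_upwards [hne, ae_restrict_mem measurableSet_Ioi] with ζ h1 h2
      have hinv : ∀ x : ℝ, x ≠ 0 → Tendsto (fun ε : ℝ => ((x : ℂ) + ε * Complex.I)⁻¹) (𝓝[>] 0)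
          (𝓝 (((x : ℂ) + (0 : ℝ) * Complex.I)⁻¹)) := by
        intro x hx
        have hcont : Continuous fun ε : ℝ => (x : ℂ) + ε * Complex.I := by fun_prop
        exact ((hcont.tendsto 0).mono_left nhdsWithin_le_nhds).inv₀ (by simpa using hx)
      have hg : Ψ ζ - Ψ lam ≠ 0 := sub_ne_zero.2 fun h => h1 (hmono.injOn h2 hlam h)
      have ht : a * (ζ - lam) ≠ 0 := mul_ne_zero ha.ne' (sub_ne_zero.2 h1)
      unfold regularizedKernel
      refine ((hinv _ hg).const_mul _).sub ?_
      by_cases hζN : ζ ∈ N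
      · simp only [← hN, indicator_of_mem hζN]
        exact (hinv _ ht).const_mul _
      · simp only [← hN, indicator_of_notMem hζN]
        exact tendsto_const_nhds
    simp_rw [regularizedKernel_zero] at hlim
    rw [integral_complex_ofReal] at hlim
    have hpole := (tendsto_integral_inv_linear_add_mul_I (lam := lam) ha (half_pos hlam)).const_mul
      (w lam : ℂ)
    refine (hlim.add hpole).congr' ?_
    filter_upwards [self_mem_nhdsWithin] with ε hε
    have hε0 : (0:ℝ) < ε := hε
    have hpint : IntegrableOn (N.indicator fun ζ : ℝ =>
        (w lam : ℂ) * (((a * (ζ - lam) : ℝ) : ℂ) + ε * Complex.I)⁻¹) (Ioi 0) := by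
      rw [IntegrableOn, integrable_indicator_iff measurableSet_Icc, IntegrableOn,
        Measure.restrict_restrict measurableSet_Icc, inter_eq_left.2 hNpos]
      refine ContinuousOn.integrableOn_compact isCompact_Icc (Continuous.continuousOn ?_)
      refine continuous_const.mul (Continuous.inv₀ (by fun_prop) fun x h => ?_)
      have := congrArg Complex.im h
      simp at this
      exact hε0.ne' this
    have hsum := integral_add (hKint ε) hpint
    rw [setIntegral_indicator measurableSet_Icc, inter_eq_right.2 hNpos,
      integral_const_mul] at hsum
    rw [← hsum]
    refine integral_congr_ae (ae_of_all _ fun ζ => ?_)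
    simp only [regularizedKernel, ← hN, sub_add_cancel]

lemma abs_poissonWeight_sub_le {ξ lam ζ : ℝ} (hξ : 0 < ξ) (hlam : 0 < lam)
    (hζ : ζ ∈ Icc (lam - lam / 2) (lam + lam / 2)) :
    |ξ ^ 2 / (ξ ^ 2 + ζ ^ 2) - ξ ^ 2 / (ξ ^ 2 + lam ^ 2)| ≤ (5 * lam / 2 / ξ ^ 2) * |ζ - lam| := by
  have hζ0 : 0 < ζ := by linarith [hζ.1]
  have hid : ξ ^ 2 / (ξ ^ 2 + ζ ^ 2) - ξ ^ 2 / (ξ ^ 2 + lam ^ 2) =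
      -((ζ - lam) * ((ζ + lam) * ξ ^ 2 / ((ξ ^ 2 + ζ ^ 2) * (ξ ^ 2 + lam ^ 2)))) := by
    field_simp; ring
  rw [hid, abs_neg, abs_mul, mul_comm]
  gcongr
  rw [abs_of_pos (by positivity), div_le_div_iff₀ (by positivity) (by positivity)]
  have h1 : ζ + lam ≤ 5 * lam / 2 := by linarith [hζ.2]
  have h2 : ξ ^ 2 * ξ ^ 2 ≤ (ξ ^ 2 + ζ ^ 2) * (ξ ^ 2 + lam ^ 2) := by
    gcongr <;> nlinarith
  calc (ζ + lam) * ξ ^ 2 * ξ ^ 2 = (ζ + lam) * (ξ ^ 2 * ξ ^ 2) := by ring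
    _ ≤ _ := by gcongr

theorem boundary_limits_of_phi (Ψ Ψ' Ψ'' : ℝ → ℝ)
    (hmono : StrictMonoOn Ψ (Ioi 0))
    (hnonneg : ∀ ζ ∈ Ioi (0:ℝ), 0 ≤ Ψ ζ)
    (hΨd1 : ∀ ζ ∈ Ioi (0:ℝ), HasDerivAt Ψ (Ψ' ζ) ζ)
    (hΨd2 : ∀ ζ ∈ Ioi (0:ℝ), HasDerivAt Ψ' (Ψ'' ζ) ζ)
    (hΨ''cont : ContinuousOn Ψ'' (Ioi 0))
    (hΨ'pos : ∀ ζ ∈ Ioi (0:ℝ), 0 < Ψ' ζ)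
    (hint : IntegrableOn (fun ζ => 1 / (1 + Ψ ζ)) (Ioi 0))
    (lam ξ : ℝ) (hlam : 0 < lam) (hξ : 0 < ξ) :
    ∃ Kl Klx : ℝ,
      Tendsto (fun ε : ℝ =>
          -(Real.pi)⁻¹ * ∫ ζ in Ioi (0:ℝ) \ Icc (lam - ε) (lam + ε),
            Ψ' lam / (Ψ lam - Ψ ζ))
        (𝓝[>] 0) (𝓝 Kl) ∧
      Tendsto (fun ε : ℝ =>
          -(Real.pi)⁻¹ * ∫ ζ in Ioi (0:ℝ) \ Icc (lam - ε) (lam + ε),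
            (ξ^2 / (ξ^2 + ζ^2)) * (Ψ' lam / (Ψ lam - Ψ ζ)))
        (𝓝[>] 0) (𝓝 Klx) ∧
      Tendsto (fun ε : ℝ => phi Ψ (-(Ψ lam : ℂ) + (ε : ℂ) * Complex.I))
        (𝓝[>] 0) (𝓝 (((Kl : ℂ) - Complex.I) / (Ψ' lam : ℂ))) ∧
      Tendsto (fun ε : ℝ => phi1 Ψ ξ (-(Ψ lam : ℂ) + (ε : ℂ) * Complex.I))
        (𝓝[>] 0)
        (𝓝 (((Klx : ℂ) - Complex.I * ((ξ^2 / (ξ^2 + lam^2) : ℝ) : ℂ)) / (Ψ' lam : ℂ))) := by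
  have ha := hΨ'pos lam hlam
  have hac : (Ψ' lam : ℂ) ≠ 0 := by exact_mod_cast ha.ne'
  have hπ : (Real.pi : ℂ) ≠ 0 := by exact_mod_cast Real.pi_ne_zero
  obtain ⟨J, hJ, hJc⟩ := exists_principalValue_and_tendsto_cauchyIntegral (w := fun _ => 1)
    (L := 0) hmono hnonneg hΨd1 hΨd2 hΨ''cont hΨ'pos hint hlam measurable_const (by simp) (by simp)
  obtain ⟨Jx, hJx, hJxc⟩ := exists_principalValue_and_tendsto_cauchyIntegral
    (w := fun ζ => ξ ^ 2 / (ξ ^ 2 + ζ ^ 2)) hmono hnonneg hΨd1 hΨd2 hΨ''cont hΨ'pos hint hlam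
    (by fun_prop)
    (fun ζ => by
      rw [abs_of_nonneg (by positivity), div_le_one (by positivity)]
      nlinarith [sq_nonneg ζ])
    (fun ζ hζ => abs_poissonWeight_sub_le hξ hlam hζ)
  have hflip : ∀ ζ, Ψ' lam / (Ψ lam - Ψ ζ) = -Ψ' lam * (Ψ ζ - Ψ lam)⁻¹ := fun ζ => by
    rw [← neg_sub (Ψ ζ), div_neg, div_eq_mul_inv, neg_mul]
  refine ⟨Real.pi⁻¹ * Ψ' lam * J, Real.pi⁻¹ * Ψ' lam * Jx, ?_, ?_, ?_, ?_⟩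
  · refine (hJ.const_mul (Real.pi⁻¹ * Ψ' lam)).congr fun ε => ?_
    simp_rw [hflip, integral_const_mul, one_mul]
    ring
  · refine (hJx.const_mul (Real.pi⁻¹ * Ψ' lam)).congr fun ε => ?_
    simp_rw [hflip, mul_left_comm _ (-Ψ' lam), integral_const_mul]
    ring
  · have h := hJc.const_mul (Real.pi : ℂ)⁻¹
    convert h using 2
    · unfold phi
      congr 2
      ext ζ
      push_cast
      ring
    · push_cast
      field_simp
      ring
  · have h := hJxc.const_mul (Real.pi : ℂ)⁻¹
    convert h using 2
    · unfold phi1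
      congr 2
      ext ζ
      push_cast
      ring
    · push_cast
      generalize (ξ : ℂ) ^ 2 / ((ξ : ℂ) ^ 2 + (lam : ℂ) ^ 2) = l
      field_simp
      ring
end

section
/- Assume Ψ : (0,∞) → [0,∞) is strictly increasing, twice continuously differentiable with Ψ'(ζ) > 0 for all ζ > 0, and ∫₀^∞ 1/(1+Ψ(ζ)) dζ < ∞. Then for all λ, ξ₁, ξ₂ > 0: lim_{ε→0⁺} Im( φ(ξ₁,ξ₂,−Ψ(λ)+iε) − φ(ξ₁,−Ψ(λ)+iε)·φ(ξ₂,−Ψ(λ)+iε)/φ(−Ψ(λ)+iε) ) = −(1/Ψ'(λ)) · (K_λ L_λ(ξ₁) − K_λ(ξ₁)) · (K_λ L_λ(ξ₂) − K_λ(ξ₂)) / (1 + K_λ²). -/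
open MeasureTheory Filter Topology Set

theorem tendsto_integral_deriv_mul_inv_add_mul_I {f f' : ℝ → ℝ} {a b : ℝ} (hab : a ≤ b)
    (hf : ∀ t ∈ Icc a b, HasDerivAt f (f' t) t) (hf' : ContinuousOn f' (Icc a b))
    (ha : f a < 0) (hb : 0 < f b) :
    Tendsto (fun ε : ℝ => ∫ t in Icc a b, (f' t : ℂ) * ((f t : ℂ) + (ε : ℂ) * Complex.I)⁻¹)
      (𝓝[>] 0) (𝓝 (((Real.log (f b) - Real.log (f a) : ℝ) : ℂ) - Real.pi * Complex.I)) := by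
  have hcongr : (fun ε : ℝ => Complex.log ((f b : ℂ) + (ε : ℂ) * Complex.I) -
      Complex.log ((f a : ℂ) + (ε : ℂ) * Complex.I)) =ᶠ[𝓝[>] 0]
      fun ε : ℝ => ∫ t in Icc a b, (f' t : ℂ) * ((f t : ℂ) + (ε : ℂ) * Complex.I)⁻¹ := by
    filter_upwards [self_mem_nhdsWithin] with ε hε
    have hε' : (0 : ℝ) < ε := hε
    have hslit : ∀ t, ((f t : ℂ) + (ε : ℂ) * Complex.I) ∈ Complex.slitPlane := fun t => by
      rw [Complex.mem_slitPlane_iff]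
      right
      simpa using hε'.ne'
    rw [integral_Icc_eq_integral_Ioc, ← intervalIntegral.integral_of_le hab]
    symm
    refine intervalIntegral.integral_eq_sub_of_hasDerivAt
      (f := fun t : ℝ => Complex.log ((f t : ℂ) + (ε : ℂ) * Complex.I)) (fun t ht => ?_) ?_
    · rw [uIcc_of_le hab] at ht
      simpa [div_eq_mul_inv] using
        ((hf t ht).ofReal_comp.add_const ((ε : ℂ) * Complex.I)).clog_real (hslit t)
    · refine ContinuousOn.intervalIntegrable ?_
      rw [uIcc_of_le hab]
      have hfc : ContinuousOn f (Icc a b) := fun t ht => (hf t ht).continuousAt.continuousWithinAt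
      refine (Complex.continuous_ofReal.comp_continuousOn hf').mul (ContinuousOn.inv₀ ?_ ?_)
      · exact (Complex.continuous_ofReal.comp_continuousOn hfc).add continuousOn_const
      · exact fun t _ => Complex.slitPlane_ne_zero (hslit t)
  refine Tendsto.congr' hcongr ?_
  have hcont : ∀ x : ℝ, Tendsto (fun ε : ℝ => (x : ℂ) + (ε : ℂ) * Complex.I) (𝓝[>] 0)
      (𝓝 (x : ℂ)) := fun x => by
    have : Continuous (fun ε : ℝ => (x : ℂ) + (ε : ℂ) * Complex.I) := by fun_prop
    simpa using (this.tendsto 0).mono_left nhdsWithin_le_nhds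
  have hB : Tendsto (fun ε : ℝ => Complex.log ((f b : ℂ) + (ε : ℂ) * Complex.I)) (𝓝[>] 0)
      (𝓝 (Real.log (f b) : ℂ)) := by
    rw [Complex.ofReal_log hb.le]
    exact (hcont (f b)).clog (Complex.ofReal_mem_slitPlane.2 hb)
  have hA : Tendsto (fun ε : ℝ => Complex.log ((f a : ℂ) + (ε : ℂ) * Complex.I)) (𝓝[>] 0)
      (𝓝 ((Real.log (f a) : ℂ) + Real.pi * Complex.I)) := by
    have := Complex.tendsto_log_nhdsWithin_im_nonneg_of_re_neg_of_im_zero (z := (f a : ℂ))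
      (by simpa using ha) (by simp)
    rw [Complex.norm_real, Real.norm_eq_abs, Real.log_abs] at this
    refine this.comp (tendsto_nhdsWithin_iff.2 ⟨hcont (f a), ?_⟩)
    filter_upwards [self_mem_nhdsWithin] with ε hε
    simpa using (le_of_lt hε : (0 : ℝ) ≤ ε)
  convert hB.sub hA using 2
  push_cast
  ring

theorem integral_Icc_deriv_div {f f' : ℝ → ℝ} {a b : ℝ} (hab : a ≤ b)
    (hf : ∀ t ∈ Icc a b, HasDerivAt f (f' t) t) (hf' : ContinuousOn f' (Icc a b))
    (hne : ∀ t ∈ Icc a b, f t ≠ 0) :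
    IntegrableOn (fun t => f' t / f t) (Icc a b) ∧
      ∫ t in Icc a b, f' t / f t = Real.log (f b) - Real.log (f a) := by
  have hfc : ContinuousOn f (Icc a b) := fun t ht => (hf t ht).continuousAt.continuousWithinAt
  have hc : ContinuousOn (fun t => f' t / f t) (Icc a b) := hf'.div hfc hne
  refine ⟨hc.integrableOn_Icc, ?_⟩
  rw [integral_Icc_eq_integral_Ioc, ← intervalIntegral.integral_of_le hab]
  refine intervalIntegral.integral_eq_sub_of_hasDerivAt (f := fun t => Real.log (f t))
    (fun t ht => ?_) ?_
  · rw [uIcc_of_le hab] at ht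
    exact (hf t ht).log (hne t ht)
  · exact ContinuousOn.intervalIntegrable (by rwa [uIcc_of_le hab])

theorem tendsto_setIntegral_deriv_div_diff {f f' : ℝ → ℝ} {a b l : ℝ} (hal : a < l) (hlb : l < b)
    (hf : ∀ t ∈ Icc a b, HasDerivAt f (f' t) t) (hf' : ContinuousOn f' (Icc a b))
    (hmono : StrictMonoOn f (Icc a b)) (hl : f l = 0) (hl' : 0 < f' l) :
    (∀ᶠ η in 𝓝[>] (0 : ℝ), IntegrableOn (fun t => f' t / f t)
      (Icc a b \ Icc (l - η) (l + η))) ∧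
    Tendsto (fun η : ℝ => ∫ t in Icc a b \ Icc (l - η) (l + η), f' t / f t)
      (𝓝[>] 0) (𝓝 (Real.log (f b) - Real.log (f a))) := by
  have hlmem : l ∈ Icc a b := ⟨hal.le, hlb.le⟩
  have hsmall : ∀ᶠ η in 𝓝[>] (0 : ℝ), 0 < η ∧ η < l - a ∧ η < b - l := by
    filter_upwards [self_mem_nhdsWithin, nhdsWithin_le_nhds (Iio_mem_nhds (sub_pos.2 hal)),
      nhdsWithin_le_nhds (Iio_mem_nhds (sub_pos.2 hlb))] with η h1 h2 h3 using ⟨h1, h2, h3⟩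
  have hpiece : ∀ η : ℝ, 0 < η → η < l - a → η < b - l →
      IntegrableOn (fun t => f' t / f t) (Icc a b \ Icc (l - η) (l + η)) ∧
      ∫ t in Icc a b \ Icc (l - η) (l + η), f' t / f t =
        (Real.log (f (l - η)) - Real.log (f a)) + (Real.log (f b) - Real.log (f (l + η))) := by
    intro η h0 h1 h2
    have hset : Icc a b \ Icc (l - η) (l + η) = Ico a (l - η) ∪ Ioc (l + η) b := by
      ext t
      simp only [Set.mem_sdiff, mem_Icc, mem_union, mem_Ico, mem_Ioc, not_and_or, not_le]
      grind
    have hL : Icc a (l - η) ⊆ Icc a b := Icc_subset_Icc le_rfl (by linarith)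
    have hR : Icc (l + η) b ⊆ Icc a b := Icc_subset_Icc (by linarith) le_rfl
    obtain ⟨iL, eL⟩ := integral_Icc_deriv_div (f := f) (f' := f') (a := a) (b := l - η)
      (by linarith) (fun t ht => hf t (hL ht)) (hf'.mono hL)
      (fun t ht => (hl ▸ hmono (hL ht) hlmem (by linarith [ht.2]) : f t < 0).ne)
    obtain ⟨iR, eR⟩ := integral_Icc_deriv_div (f := f) (f' := f') (a := l + η) (b := b)
      (by linarith) (fun t ht => hf t (hR ht)) (hf'.mono hR)
      (fun t ht => (hl ▸ hmono hlmem (hR ht) (by linarith [ht.1]) : 0 < f t).ne')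
    rw [hset, setIntegral_union _ measurableSet_Ioc (iL.mono_set Ico_subset_Icc_self)
      (iR.mono_set Ioc_subset_Icc_self), ← integral_Icc_eq_integral_Ico, eL,
      ← integral_Icc_eq_integral_Ioc, eR]
    · exact ⟨(iL.mono_set Ico_subset_Icc_self).union (iR.mono_set Ioc_subset_Icc_self), rfl⟩
    · rw [Set.disjoint_left]
      intro t ht ht'
      linarith [ht.2, ht'.1]
  refine ⟨hsmall.mono fun η h => (hpiece η h.1 h.2.1 h.2.2).1, ?_⟩
  have hplus : Tendsto (fun η : ℝ => Real.log (η⁻¹ * f (l + η))) (𝓝[>] 0)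
      (𝓝 (Real.log (f' l))) := by
    have := (hf l hlmem).tendsto_slope_zero_right
    simp only [hl, sub_zero, smul_eq_mul] at this
    exact this.log hl'.ne'
  have hminus : Tendsto (fun η : ℝ => Real.log (η⁻¹ * f (l - η))) (𝓝[>] 0)
      (𝓝 (Real.log (f' l))) := by
    have h1 := (hf l hlmem).tendsto_slope_zero_left
    have h2 : Tendsto (fun η : ℝ => -η) (𝓝[>] 0) (𝓝[<] 0) := by
      simpa using tendsto_neg_nhdsGT (a := (0 : ℝ))
    have := (h1.log hl'.ne').comp h2
    simpa [Function.comp_def, hl, inv_neg, ← sub_eq_add_neg] using this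
  have hlim := (hminus.sub hplus).add_const (Real.log (f b) - Real.log (f a))
  rw [sub_self, zero_add] at hlim
  refine hlim.congr' ?_
  filter_upwards [hsmall] with η ⟨h0, h1, h2⟩
  have hp : 0 < f (l + η) :=
    hl ▸ hmono hlmem ⟨by linarith, by linarith⟩ (by linarith)
  have hm : f (l - η) < 0 :=
    hl ▸ hmono ⟨by linarith, by linarith⟩ hlmem (by linarith)
  rw [(hpiece η h0 h1 h2).2, Real.log_mul (inv_pos.2 h0).ne' hm.ne,
    Real.log_mul (inv_pos.2 h0).ne' hp.ne']
  ring

theorem integrableOn_Icc_div_of_common_zero {h f : ℝ → ℝ} {a b l f' : ℝ} (hal : a < l) (hlb : l < b)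
    (hh : ContinuousOn h (Icc a b)) (hhd : DifferentiableAt ℝ h l) (hhl : h l = 0)
    (hf : ContinuousOn f (Icc a b)) (hfd : HasDerivAt f f' l) (hf' : f' ≠ 0)
    (hfl : f l = 0) (hne : ∀ t ∈ Icc a b, t ≠ l → f t ≠ 0) :
    IntegrableOn (fun t => h t / f t) (Icc a b) := by
  have hnhds : Icc a b ∈ 𝓝 l := Icc_mem_nhds hal hlb
  have hc : ContinuousOn (fun t => dslope h l t / dslope f l t) (Icc a b) := by
    refine ((continuousOn_dslope hnhds).2 ⟨hh, hhd⟩).div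
      ((continuousOn_dslope hnhds).2 ⟨hf, hfd.differentiableAt⟩) fun t ht => ?_
    rcases eq_or_ne t l with rfl | htl
    · rwa [dslope_same, hfd.deriv]
    · rw [dslope_of_ne f htl, slope_def_field, hfl, sub_zero]
      exact div_ne_zero (hne t ht htl) (sub_ne_zero.2 htl)
  refine hc.integrableOn_Icc.congr_fun_ae ?_
  filter_upwards [Measure.ae_ne (volume.restrict (Icc a b)) l] with t htl
  rw [dslope_of_ne h htl, dslope_of_ne f htl, slope_def_field, slope_def_field, hfl, hhl,
    sub_zero, sub_zero, div_div_div_cancel_right₀ (sub_ne_zero.2 htl)]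

/-- Subtracting `c Ψ'` near the singularity, with `c` chosen to cancel it, leaves an integrable
function. -/
theorem integrableOn_Ioi_sub_indicator_div {Ψ Ψ' g : ℝ → ℝ} {a b l : ℝ}
    (hmono : StrictMonoOn Ψ (Ioi 0))
    (hnonneg : ∀ ζ ∈ Ioi (0:ℝ), 0 ≤ Ψ ζ)
    (hΨ : ∀ ζ ∈ Ioi (0:ℝ), HasDerivAt Ψ (Ψ' ζ) ζ)
    (hΨ' : ContinuousOn Ψ' (Ioi 0)) (hΨ'd : DifferentiableAt ℝ Ψ' l) (hpos : 0 < Ψ' l)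
    (hint : IntegrableOn (fun ζ => 1 / (1 + Ψ ζ)) (Ioi 0))
    (ha : 0 < a) (hal : a < l) (hlb : l < b)
    (hg : ContinuousOn g (Ioi 0)) (hgd : DifferentiableAt ℝ g l)
    (hg1 : ∀ ζ ∈ Ioi (0:ℝ), |g ζ| ≤ 1) :
    IntegrableOn (fun ζ => (g ζ - (Icc a b).indicator (fun t => g l / Ψ' l * Ψ' t) ζ) /
      (Ψ ζ - Ψ l)) (Ioi 0) := by
  have hl0 : (0 : ℝ) < l := ha.trans hal
  have hΨc : ContinuousOn Ψ (Ioi 0) := fun t ht => (hΨ t ht).continuousAt.continuousWithinAt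
  have hne : ∀ t ∈ Ioi (0 : ℝ), t ≠ l → Ψ t - Ψ l ≠ 0 := fun t ht htl =>
    sub_ne_zero.2 fun h => htl (hmono.injOn ht hl0 h)
  have hsub : Icc a b ⊆ Ioi 0 := fun t ht => ha.trans_le ht.1
  have hunion : Ioi (0 : ℝ) = (Ioo 0 a ∪ Icc a b) ∪ Ioi b := by
    ext t
    simp only [mem_union, mem_Ioi, mem_Ioo, mem_Icc]
    grind
  rw [hunion]
  refine (IntegrableOn.union ?_ ?_).union ?_
  · have hsubL : Ioo 0 a ⊆ Ioi (0 : ℝ) := fun t ht => ht.1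
    have hda : 0 < Ψ l - Ψ a := sub_pos.2 (hmono ha hl0 hal)
    refine IntegrableOn.congr_fun (f := fun ζ => g ζ / (Ψ ζ - Ψ l)) ?_ (fun t ht => ?_)
      measurableSet_Ioo
    · refine Integrable.mono' (g := fun _ => 1 / (Ψ l - Ψ a))
        (integrableOn_const (by simp)) ?_ ?_
      · exact ((hg.mono hsubL).div ((hΨc.mono hsubL).sub continuousOn_const)
          fun t ht => hne t (hsubL ht) (ht.2.trans hal).ne).aestronglyMeasurable measurableSet_Ioo
      · filter_upwards [ae_restrict_mem measurableSet_Ioo] with t ht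
        have hta := hmono ht.1 ha ht.2
        rw [Real.norm_eq_abs, abs_div]
        have : Ψ l - Ψ a ≤ |Ψ t - Ψ l| := by
          rw [abs_sub_comm]
          exact le_trans (by linarith) (le_abs_self _)
        exact div_le_div₀ zero_le_one (hg1 t ht.1) hda this
    · have : t ∉ Icc a b := fun h => absurd h.1 (not_le.2 ht.2)
      simp [this]
  · refine IntegrableOn.congr_fun (f := fun ζ => (g ζ - g l / Ψ' l * Ψ' ζ) / (Ψ ζ - Ψ l)) ?_
      (fun t ht => by simp [indicator_of_mem ht]) measurableSet_Icc
    refine integrableOn_Icc_div_of_common_zero (f := fun ζ => Ψ ζ - Ψ l)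
      (h := fun ζ => g ζ - g l / Ψ' l * Ψ' ζ) hal hlb
      ((hg.mono hsub).sub (continuousOn_const.mul (hΨ'.mono hsub)))
      (hgd.sub (hΨ'd.const_mul _)) ?_ ((hΨc.mono hsub).sub continuousOn_const)
      ((hΨ l hl0).sub_const _) hpos.ne' (sub_self _) fun t ht => hne t (hsub ht)
    field_simp
    simp
  · have hb0 : (0 : ℝ) < b := hl0.trans hlb
    have hsubR : Ioi b ⊆ Ioi (0 : ℝ) := fun t ht => hb0.trans ht
    have hdb : 0 < Ψ b - Ψ l := sub_pos.2 (hmono hl0 hb0 hlb)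
    refine IntegrableOn.congr_fun (f := fun ζ => g ζ / (Ψ ζ - Ψ l)) ?_ (fun t ht => ?_)
      measurableSet_Ioi
    · refine Integrable.mono' ((hint.mono_set hsubR).const_mul
        (1 + (1 + Ψ l) / (Ψ b - Ψ l))) ?_ ?_
      · exact ((hg.mono hsubR).div ((hΨc.mono hsubR).sub continuousOn_const)
          fun t ht => hne t (hsubR ht) (hlb.trans ht).ne').aestronglyMeasurable measurableSet_Ioi
      · filter_upwards [ae_restrict_mem measurableSet_Ioi] with t ht
        have htb := hmono hb0 (hsubR ht) ht
        have h0 := hnonneg t (hsubR ht)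
        have hl := hnonneg l hl0
        have hx : 0 < Ψ t - Ψ l := by linarith
        rw [Real.norm_eq_abs, abs_div, abs_of_pos hx]
        calc |g t| / (Ψ t - Ψ l) ≤ 1 / (Ψ t - Ψ l) := by gcongr; exact hg1 t (hsubR ht)
          _ = (1 + (1 + Ψ l) / (Ψ t - Ψ l)) * (1 / (1 + Ψ t)) := by field_simp; ring
          _ ≤ (1 + (1 + Ψ l) / (Ψ b - Ψ l)) * (1 / (1 + Ψ t)) := by gcongr
    · have : t ∉ Icc a b := fun h => absurd h.2 (not_le.2 ht)
      simp [this]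

/-- Sokhotski–Plemelj formula for `g / (Ψ - Ψ l)`: the principal value at `l` exists, and the
boundary value from the upper half-plane differs from it by `-π i g(l) / Ψ'(l)`. -/
theorem exists_tendsto_principalValue_and_boundaryValue {Ψ Ψ' g : ℝ → ℝ} {l : ℝ}
    (hmono : StrictMonoOn Ψ (Ioi 0))
    (hnonneg : ∀ ζ ∈ Ioi (0:ℝ), 0 ≤ Ψ ζ)
    (hΨ : ∀ ζ ∈ Ioi (0:ℝ), HasDerivAt Ψ (Ψ' ζ) ζ)
    (hΨ' : ContinuousOn Ψ' (Ioi 0)) (hΨ'd : DifferentiableAt ℝ Ψ' l) (hpos : 0 < Ψ' l)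
    (hint : IntegrableOn (fun ζ => 1 / (1 + Ψ ζ)) (Ioi 0)) (hl : 0 < l)
    (hg : ContinuousOn g (Ioi 0)) (hgd : DifferentiableAt ℝ g l)
    (hg1 : ∀ ζ ∈ Ioi (0:ℝ), |g ζ| ≤ 1) :
    ∃ V : ℝ,
      Tendsto (fun η : ℝ => ∫ ζ in Ioi (0:ℝ) \ Icc (l - η) (l + η), g ζ / (Ψ ζ - Ψ l))
        (𝓝[>] 0) (𝓝 V) ∧
      Tendsto (fun ε : ℝ => ∫ ζ in Ioi (0:ℝ),
          (g ζ : ℂ) * ((Ψ ζ : ℂ) + (-(Ψ l : ℂ) + (ε : ℂ) * Complex.I))⁻¹)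
        (𝓝[>] 0) (𝓝 ((V : ℂ) - ((g l / Ψ' l : ℝ) : ℂ) * (Real.pi * Complex.I))) := by
  obtain ⟨a, ha, hal⟩ := exists_between hl
  obtain ⟨b, hlb⟩ := exists_gt l
  set c : ℝ := g l / Ψ' l with hc
  set s : ℝ → ℝ := (Icc a b).indicator (fun t => c * Ψ' t) with hs
  have hH := integrableOn_Ioi_sub_indicator_div hmono hnonneg hΨ hΨ' hΨ'd hpos hint ha hal hlb
    hg hgd hg1
  rw [← hc, ← hs] at hH
  have hab : a ≤ b := (hal.trans hlb).le
  have hsub : Icc a b ⊆ Ioi 0 := fun t ht => ha.trans_le ht.1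
  have hΨc : ContinuousOn Ψ (Ioi 0) := fun t ht => (hΨ t ht).continuousAt.continuousWithinAt
  have hd : ∀ t ∈ Icc a b, HasDerivAt (fun ζ => Ψ ζ - Ψ l) (Ψ' t) t :=
    fun t ht => (hΨ t (hsub ht)).sub_const _
  have hfa : Ψ a - Ψ l < 0 := sub_neg.2 (hmono ha hl hal)
  have hfb : 0 < Ψ b - Ψ l := sub_pos.2 (hmono hl (hl.trans hlb) hlb)
  have hmonof : StrictMonoOn (fun ζ => Ψ ζ - Ψ l) (Icc a b) := fun x hx y hy hxy =>
    sub_lt_sub_right (hmono (hsub hx) (hsub hy) hxy) _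
  have hs_meas : AEStronglyMeasurable s (volume.restrict (Ioi 0)) := by
    have : AEStronglyMeasurable (fun t => c * Ψ' t) (volume.restrict (Ioi 0)) :=
      (continuousOn_const.mul hΨ').aestronglyMeasurable measurableSet_Ioi
    exact this.indicator measurableSet_Icc
  have hg_meas : AEStronglyMeasurable g (volume.restrict (Ioi 0)) :=
    hg.aestronglyMeasurable measurableSet_Ioi
  set W : ℝ := Real.log (Ψ b - Ψ l) - Real.log (Ψ a - Ψ l) with hW
  refine ⟨(∫ ζ in Ioi (0:ℝ), (g ζ - s ζ) / (Ψ ζ - Ψ l)) + c * W, ?_, ?_⟩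
  · obtain ⟨hI, hlim⟩ := tendsto_setIntegral_deriv_div_diff hal hlb hd (hΨ'.mono hsub) hmonof
      (sub_self _) hpos
    have hreg : Tendsto (fun η : ℝ => ∫ ζ in Ioi (0:ℝ) \ Icc (l - η) (l + η),
        (g ζ - s ζ) / (Ψ ζ - Ψ l)) (𝓝[>] 0)
        (𝓝 (∫ ζ in Ioi (0:ℝ), (g ζ - s ζ) / (Ψ ζ - Ψ l))) := by
      have hrw : ∀ η : ℝ, ∫ ζ in Ioi (0:ℝ) \ Icc (l - η) (l + η), (g ζ - s ζ) / (Ψ ζ - Ψ l) =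
          ∫ ζ in Ioi (0:ℝ), (Icc (l - η) (l + η))ᶜ.indicator
            (fun ζ => (g ζ - s ζ) / (Ψ ζ - Ψ l)) ζ := fun η => by
        rw [setIntegral_indicator measurableSet_Icc.compl, sdiff_eq]
      simp_rw [hrw]
      refine MeasureTheory.tendsto_integral_filter_of_dominated_convergence
        (fun ζ => ‖(g ζ - s ζ) / (Ψ ζ - Ψ l)‖) (.of_forall fun η => ?_) (.of_forall fun η => ?_)
        hH.norm ?_
      · exact hH.aestronglyMeasurable.indicator measurableSet_Icc.compl
      · exact .of_forall fun ζ => norm_indicator_le_norm_self _ _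
      · filter_upwards [Measure.ae_ne (volume.restrict (Ioi 0)) l] with ζ hζ
        refine tendsto_const_nhds.congr' ?_
        filter_upwards [nhdsWithin_le_nhds (Iio_mem_nhds (abs_pos.2 (sub_ne_zero.2 hζ)))]
          with η hη
        rw [indicator_of_mem]
        intro h
        have : |ζ - l| ≤ η := abs_le.2 ⟨by linarith [h.1], by linarith [h.2]⟩
        exact absurd hη (not_lt.2 this)
    refine (hreg.add (hlim.const_mul c)).congr' ?_
    filter_upwards [hI] with η hη
    have hsd : ∀ ζ, s ζ / (Ψ ζ - Ψ l) =
        (Icc a b).indicator (fun t => c * (Ψ' t / (Ψ t - Ψ l))) ζ := fun ζ => by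
      by_cases h : ζ ∈ Icc a b
      · simp only [hs, indicator_of_mem h, mul_div_assoc]
      · simp only [hs, indicator_of_notMem h, zero_div]
    have hset : (Ioi 0 \ Icc (l - η) (l + η)) ∩ Icc a b = Icc a b \ Icc (l - η) (l + η) := by
      ext t
      simp only [mem_inter_iff, Set.mem_sdiff]
      exact ⟨fun h => ⟨h.2, h.1.2⟩, fun h => ⟨⟨hsub h.1, h.2⟩, h.1⟩⟩
    have hsing : ∫ ζ in Ioi (0:ℝ) \ Icc (l - η) (l + η), s ζ / (Ψ ζ - Ψ l) =
        c * ∫ t in Icc a b \ Icc (l - η) (l + η), Ψ' t / (Ψ t - Ψ l) := by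
      simp_rw [hsd]
      rw [setIntegral_indicator measurableSet_Icc, hset, integral_const_mul]
    have hsing_int : IntegrableOn (fun ζ => s ζ / (Ψ ζ - Ψ l))
        (Ioi (0:ℝ) \ Icc (l - η) (l + η)) := by
      simp_rw [hsd]
      rw [integrableOn_indicator_iff measurableSet_Icc, inter_comm, hset]
      exact hη.const_mul c
    rw [← hsing, ← integral_add (hH.mono_set sdiff_subset) hsing_int]
    refine integral_congr_ae (.of_forall fun ζ => ?_)
    simp only
    ring
  · have hlim := tendsto_integral_deriv_mul_inv_add_mul_I hab hd (hΨ'.mono hsub) hfa hfb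
    have hbound : ∀ᵐ ζ ∂volume.restrict (Ioi (0:ℝ)), ∀ ε : ℝ,
        ‖((g ζ - s ζ : ℝ) : ℂ) * (((Ψ ζ - Ψ l : ℝ) : ℂ) + (ε : ℂ) * Complex.I)⁻¹‖ ≤
          ‖(g ζ - s ζ) / (Ψ ζ - Ψ l)‖ := by
      filter_upwards [Measure.ae_ne (volume.restrict (Ioi 0)) l,
        ae_restrict_mem measurableSet_Ioi] with ζ hζ hζ0 ε
      have hx : 0 < |Ψ ζ - Ψ l| := abs_pos.2 (sub_ne_zero.2 fun h => hζ (hmono.injOn hζ0 hl h))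
      have hle : |Ψ ζ - Ψ l| ≤ ‖((Ψ ζ - Ψ l : ℝ) : ℂ) + (ε : ℂ) * Complex.I‖ := by
        simpa using Complex.abs_re_le_norm (((Ψ ζ - Ψ l : ℝ) : ℂ) + (ε : ℂ) * Complex.I)
      rw [norm_mul, norm_inv, Complex.norm_real, norm_div, div_eq_mul_inv,
        Real.norm_eq_abs (Ψ ζ - Ψ l)]
      gcongr
    have hmeas : ∀ ε : ℝ, AEStronglyMeasurable (fun ζ => ((g ζ - s ζ : ℝ) : ℂ) *
        (((Ψ ζ - Ψ l : ℝ) : ℂ) + (ε : ℂ) * Complex.I)⁻¹) (volume.restrict (Ioi 0)) := fun ε => by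
      have h1 : AEMeasurable (fun ζ => Ψ ζ - Ψ l) (volume.restrict (Ioi 0)) :=
        (hΨc.aemeasurable measurableSet_Ioi).sub_const _
      exact ((Complex.measurable_ofReal.comp_aemeasurable
        (hg_meas.aemeasurable.sub hs_meas.aemeasurable)).mul
        ((Complex.measurable_ofReal.comp_aemeasurable h1).add_const _).inv).aestronglyMeasurable
    have hreg : Tendsto (fun ε : ℝ => ∫ ζ in Ioi (0:ℝ),
        ((g ζ - s ζ : ℝ) : ℂ) * (((Ψ ζ - Ψ l : ℝ) : ℂ) + (ε : ℂ) * Complex.I)⁻¹) (𝓝[>] 0)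
        (𝓝 (∫ ζ in Ioi (0:ℝ), (((g ζ - s ζ) / (Ψ ζ - Ψ l) : ℝ) : ℂ))) := by
      refine MeasureTheory.tendsto_integral_filter_of_dominated_convergence
        (fun ζ => ‖(g ζ - s ζ) / (Ψ ζ - Ψ l)‖) (.of_forall hmeas)
        (.of_forall fun ε => hbound.mono fun ζ h => h ε) hH.norm ?_
      filter_upwards [Measure.ae_ne (volume.restrict (Ioi 0)) l,
        ae_restrict_mem measurableSet_Ioi] with ζ hζ hζ0
      have hx : ((Ψ ζ - Ψ l : ℝ) : ℂ) ≠ 0 :=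
        Complex.ofReal_ne_zero.2 (sub_ne_zero.2 fun h => hζ (hmono.injOn hζ0 hl h))
      have hcont : Continuous (fun ε : ℝ => ((Ψ ζ - Ψ l : ℝ) : ℂ) + (ε : ℂ) * Complex.I) := by
        fun_prop
      have h0 : Tendsto (fun ε : ℝ => ((Ψ ζ - Ψ l : ℝ) : ℂ) + (ε : ℂ) * Complex.I) (𝓝[>] 0)
          (𝓝 ((Ψ ζ - Ψ l : ℝ) : ℂ)) := by
        simpa using (hcont.tendsto 0).mono_left nhdsWithin_le_nhds
      rw [Complex.ofReal_div, div_eq_mul_inv]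
      exact (h0.inv₀ hx).const_mul _
    rw [integral_complex_ofReal] at hreg
    have hsum := hreg.add (hlim.const_mul (c : ℂ))
    refine (hsum.congr' ?_).trans (le_of_eq (congrArg 𝓝 ?_))
    swap
    · rw [← hW, Complex.ofReal_add, Complex.ofReal_mul]
      ring
    filter_upwards [self_mem_nhdsWithin] with ε hε
    have hε0 : (ε : ℝ) ≠ 0 := (show (0 : ℝ) < ε from hε).ne'
    have hsd : ∀ ζ, (s ζ : ℂ) * (((Ψ ζ - Ψ l : ℝ) : ℂ) + (ε : ℂ) * Complex.I)⁻¹ =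
        (Icc a b).indicator (fun t => (c : ℂ) *
          ((Ψ' t : ℂ) * (((Ψ t - Ψ l : ℝ) : ℂ) + (ε : ℂ) * Complex.I)⁻¹)) ζ := fun ζ => by
      by_cases h : ζ ∈ Icc a b
      · simp only [hs, indicator_of_mem h, Complex.ofReal_mul, mul_assoc]
      · simp only [hs, indicator_of_notMem h, Complex.ofReal_zero, zero_mul]
    have hset : Ioi 0 ∩ Icc a b = Icc a b := inter_eq_right.2 hsub
    have hsing : ∫ ζ in Ioi (0:ℝ),
          (s ζ : ℂ) * (((Ψ ζ - Ψ l : ℝ) : ℂ) + (ε : ℂ) * Complex.I)⁻¹ =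
        c * ∫ t in Icc a b, (Ψ' t : ℂ) * (((Ψ t - Ψ l : ℝ) : ℂ) + (ε : ℂ) * Complex.I)⁻¹ := by
      simp_rw [hsd]
      rw [setIntegral_indicator measurableSet_Icc, hset, integral_const_mul]
    have hsing_int : IntegrableOn (fun ζ =>
        (s ζ : ℂ) * (((Ψ ζ - Ψ l : ℝ) : ℂ) + (ε : ℂ) * Complex.I)⁻¹) (Ioi 0) := by
      simp_rw [hsd]
      rw [integrableOn_indicator_iff measurableSet_Icc, inter_comm, hset]
      refine ContinuousOn.integrableOn_Icc (continuousOn_const.mul ?_)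
      refine (Complex.continuous_ofReal.comp_continuousOn (hΨ'.mono hsub)).mul
        (ContinuousOn.inv₀ ?_ fun t _ h => hε0 ?_)
      · exact (Complex.continuous_ofReal.comp_continuousOn
          ((hΨc.mono hsub).sub continuousOn_const)).add continuousOn_const
      · simpa using congrArg Complex.im h
    rw [← hsing, ← integral_add (Integrable.mono hH (hmeas ε) (hbound.mono fun ζ h => h ε))
      hsing_int]
    refine integral_congr_ae (.of_forall fun ζ => ?_)
    simp only
    push_cast
    ring

theorem boundary_limit_of_im_phiTilde (Ψ Ψ' Ψ'' : ℝ → ℝ)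
    (hmono : StrictMonoOn Ψ (Ioi 0))
    (hnonneg : ∀ ζ ∈ Ioi (0:ℝ), 0 ≤ Ψ ζ)
    (hΨd1 : ∀ ζ ∈ Ioi (0:ℝ), HasDerivAt Ψ (Ψ' ζ) ζ)
    (hΨd2 : ∀ ζ ∈ Ioi (0:ℝ), HasDerivAt Ψ' (Ψ'' ζ) ζ)
    (hΨ''cont : ContinuousOn Ψ'' (Ioi 0))
    (hΨ'pos : ∀ ζ ∈ Ioi (0:ℝ), 0 < Ψ' ζ)
    (hint : IntegrableOn (fun ζ => 1 / (1 + Ψ ζ)) (Ioi 0))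
    (lam ξ₁ ξ₂ : ℝ) (hlam : 0 < lam) (hξ₁ : 0 < ξ₁) (hξ₂ : 0 < ξ₂)
    (Kl Kx₁ Kx₂ : ℝ)
    (hKl : Tendsto (fun ε : ℝ =>
        -(Real.pi)⁻¹ * ∫ ζ in Ioi (0:ℝ) \ Icc (lam - ε) (lam + ε),
          Ψ' lam / (Ψ lam - Ψ ζ))
      (𝓝[>] 0) (𝓝 Kl))
    (hKx₁ : Tendsto (fun ε : ℝ =>
        -(Real.pi)⁻¹ * ∫ ζ in Ioi (0:ℝ) \ Icc (lam - ε) (lam + ε),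
          (ξ₁^2 / (ξ₁^2 + ζ^2)) * (Ψ' lam / (Ψ lam - Ψ ζ)))
      (𝓝[>] 0) (𝓝 Kx₁))
    (hKx₂ : Tendsto (fun ε : ℝ =>
        -(Real.pi)⁻¹ * ∫ ζ in Ioi (0:ℝ) \ Icc (lam - ε) (lam + ε),
          (ξ₂^2 / (ξ₂^2 + ζ^2)) * (Ψ' lam / (Ψ lam - Ψ ζ)))
      (𝓝[>] 0) (𝓝 Kx₂)) :
    Tendsto (fun ε : ℝ =>
        (phi2 Ψ ξ₁ ξ₂ (-(Ψ lam : ℂ) + (ε : ℂ) * Complex.I) -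
          phi1 Ψ ξ₁ (-(Ψ lam : ℂ) + (ε : ℂ) * Complex.I) *
            phi1 Ψ ξ₂ (-(Ψ lam : ℂ) + (ε : ℂ) * Complex.I) /
              phi Ψ (-(Ψ lam : ℂ) + (ε : ℂ) * Complex.I)).im)
      (𝓝[>] 0)
      (𝓝 (-(1 / Ψ' lam) *
        ((Kl * (ξ₁^2 / (ξ₁^2 + lam^2)) - Kx₁) * (Kl * (ξ₂^2 / (ξ₂^2 + lam^2)) - Kx₂))
          / (1 + Kl^2))) := by
  have hΨ' : ContinuousOn Ψ' (Ioi 0) := fun t ht => (hΨd2 t ht).continuousAt.continuousWithinAt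
  have hΨ'd : DifferentiableAt ℝ Ψ' lam := (hΨd2 lam hlam).differentiableAt
  have hp := hΨ'pos lam hlam
  have key := fun (g : ℝ → ℝ) => exists_tendsto_principalValue_and_boundaryValue (g := g) hmono
    hnonneg hΨd1 hΨ' hΨ'd hp hint hlam
  have hLd : ∀ ξ : ℝ, 0 < ξ → Differentiable ℝ fun ζ : ℝ => ξ^2 / (ξ^2 + ζ^2) := fun ξ hξ =>
    (differentiable_const _).div (by fun_prop) fun ζ => by positivity
  have hL1 : ∀ ξ : ℝ, 0 < ξ → ∀ ζ : ℝ, |ξ^2 / (ξ^2 + ζ^2)| ≤ 1 := fun ξ hξ ζ => by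
    rw [abs_of_nonneg (by positivity)]
    exact div_le_one_of_le₀ (by linarith [sq_nonneg ζ]) (by positivity)
  have boundary_value : ∀ (g : ℝ → ℝ) (K : ℝ), ContinuousOn g (Ioi 0) →
      DifferentiableAt ℝ g lam → (∀ ζ ∈ Ioi (0:ℝ), |g ζ| ≤ 1) →
      Tendsto (fun ε : ℝ => -(Real.pi)⁻¹ * ∫ ζ in Ioi (0:ℝ) \ Icc (lam - ε) (lam + ε),
        g ζ * (Ψ' lam / (Ψ lam - Ψ ζ))) (𝓝[>] 0) (𝓝 K) →
      Tendsto (fun ε : ℝ => (Real.pi : ℂ)⁻¹ * ∫ ζ in Ioi (0:ℝ),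
        (g ζ : ℂ) * ((Ψ ζ : ℂ) + (-(Ψ lam : ℂ) + (ε : ℂ) * Complex.I))⁻¹) (𝓝[>] 0)
        (𝓝 (((K : ℂ) - (g lam : ℂ) * Complex.I) / (Ψ' lam : ℂ))) := by
    intro g K hg hgd hg1 hK
    obtain ⟨V, hV, hlim⟩ := key g hg hgd hg1
    have hKV : K = Real.pi⁻¹ * (Ψ' lam * V) := by
      refine tendsto_nhds_unique hK (((hV.const_mul (Ψ' lam)).const_mul Real.pi⁻¹).congr fun η => ?_)
      rw [neg_mul, ← mul_neg, ← integral_neg, ← integral_const_mul]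
      congr 2
      ext ζ
      rw [← neg_sub (Ψ ζ) (Ψ lam), div_neg]
      ring
    have hπ : (Real.pi : ℂ) ≠ 0 := Complex.ofReal_ne_zero.2 Real.pi_ne_zero
    have hp' : (Ψ' lam : ℂ) ≠ 0 := Complex.ofReal_ne_zero.2 hp.ne'
    refine (hlim.const_mul (Real.pi : ℂ)⁻¹).trans (le_of_eq (congrArg 𝓝 ?_))
    rw [hKV]
    push_cast
    field_simp
  have h0 : Tendsto (fun ε : ℝ => phi Ψ (-(Ψ lam : ℂ) + (ε : ℂ) * Complex.I)) (𝓝[>] 0)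
      (𝓝 (((Kl : ℂ) - Complex.I) / (Ψ' lam : ℂ))) := by
    simpa [phi] using boundary_value (fun _ => 1) Kl continuousOn_const
      (differentiableAt_const _) (by simp) (by simpa using hKl)
  have h1 := boundary_value _ Kx₁ (hLd ξ₁ hξ₁).continuous.continuousOn (hLd ξ₁ hξ₁ lam)
    (fun ζ _ => hL1 ξ₁ hξ₁ ζ) hKx₁
  have h2 := boundary_value _ Kx₂ (hLd ξ₂ hξ₂).continuous.continuousOn (hLd ξ₂ hξ₂ lam)
    (fun ζ _ => hL1 ξ₂ hξ₂ ζ) hKx₂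
  obtain ⟨V, -, h12⟩ := key (fun ζ => ξ₁^2 / (ξ₁^2 + ζ^2) * (ξ₂^2 / (ξ₂^2 + ζ^2)))
    ((hLd ξ₁ hξ₁).mul (hLd ξ₂ hξ₂)).continuous.continuousOn
    ((hLd ξ₁ hξ₁).mul (hLd ξ₂ hξ₂) lam)
    (fun ζ _ => by
      rw [abs_mul]
      exact mul_le_one₀ (hL1 ξ₁ hξ₁ ζ) (abs_nonneg _) (hL1 ξ₂ hξ₂ ζ))
  have hp' : (Ψ' lam : ℂ) ≠ 0 := Complex.ofReal_ne_zero.2 hp.ne'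
  have hK : (Kl : ℂ) - Complex.I ≠ 0 := fun h => by simpa using congrArg Complex.im h
  have hlim := (Complex.continuous_im.tendsto _).comp ((h12.const_mul (Real.pi : ℂ)⁻¹).sub
    ((h1.mul h2).div h0 (div_ne_zero hK hp')))
  refine hlim.trans (le_of_eq (congrArg 𝓝 ?_))
  generalize ξ₁^2 / (ξ₁^2 + lam^2) = L₁
  generalize ξ₂^2 / (ξ₂^2 + lam^2) = L₂
  have hK' : (Kl : ℂ) + Complex.I ≠ 0 := fun h => by simpa using congrArg Complex.im h
  have hKsq : (1 : ℝ) + Kl^2 ≠ 0 := by positivity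
  have hquot : ((Kx₁ : ℂ) - L₁ * Complex.I) / Ψ' lam * (((Kx₂ : ℂ) - L₂ * Complex.I) / Ψ' lam) /
      (((Kl : ℂ) - Complex.I) / Ψ' lam) =
      ((1 / (Ψ' lam * (1 + Kl^2)) : ℝ) : ℂ) *
        (((Kx₁ : ℂ) - L₁ * Complex.I) * ((Kx₂ : ℂ) - L₂ * Complex.I) * (Kl + Complex.I)) := by
    have hsq : ((Kl : ℂ) - Complex.I) * (Kl + Complex.I) = 1 + (Kl : ℂ)^2 := by
      ring_nf
      rw [Complex.I_sq]
      ring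
    push_cast
    rw [← hsq]
    field_simp
  have hπ := Real.pi_ne_zero
  rw [hquot, ← Complex.ofReal_inv, Complex.sub_im, Complex.im_ofReal_mul, Complex.im_ofReal_mul]
  simp
  field_simp
  ring
end

section
/- Assume Ψ : (0,∞) → [0,∞) is strictly increasing, twice continuously differentiable with Ψ'(ζ) > 0 for all ζ > 0, and ∫₀^∞ 1/(1+Ψ(ζ)) dζ < ∞. Then for all λ, ξ > 0 one has K_λ · L_λ(ξ) − K_λ(ξ) ≥ 0. -/
open MeasureTheory Filter Topology Set

/-- Away from `lam`, the quotient `c / (Ψ lam - Ψ ζ)` is integrable on the half-line as soon as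
`1 / (1 + Ψ)` is. -/
lemma integrableOn_div_sub_diff_Icc {Ψ : ℝ → ℝ} (hmono : StrictMonoOn Ψ (Ioi 0))
    (hnonneg : ∀ ζ ∈ Ioi (0:ℝ), 0 ≤ Ψ ζ) (hcont : ContinuousOn Ψ (Ioi 0))
    (hint : IntegrableOn (fun ζ => 1 / (1 + Ψ ζ)) (Ioi 0))
    (c : ℝ) {lam ε : ℝ} (hε : 0 < ε) (hεlam : ε < lam) :
    IntegrableOn (fun ζ => c / (Ψ lam - Ψ ζ)) (Ioi 0 \ Icc (lam - ε) (lam + ε)) := by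
  have hlam : 0 < lam := hε.trans hεlam
  have ha : Ψ (lam - ε) < Ψ lam := hmono (mem_Ioi.2 (by linarith)) hlam (by linarith)
  have hb : Ψ lam < Ψ (lam + ε) := hmono hlam (mem_Ioi.2 (by linarith)) (by linarith)
  have hp := hnonneg lam hlam
  have ha0 := hnonneg (lam - ε) (mem_Ioi.2 (by linarith))
  have hS : MeasurableSet (Ioi (0:ℝ) \ Icc (lam - ε) (lam + ε)) :=
    measurableSet_Ioi.diff measurableSet_Icc
  set A := (1 + Ψ (lam - ε)) / (Ψ lam - Ψ (lam - ε)) with hA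
  set B := (1 + Ψ (lam + ε)) / (Ψ (lam + ε) - Ψ lam) with hB
  have hA0 : 0 ≤ A := div_nonneg (by linarith) (by linarith)
  have hB0 : 0 ≤ B := div_nonneg (by linarith) (by linarith)
  refine Integrable.mono' ((hint.mono_set sdiff_subset).const_mul (|c| * (A + B))) ?_ ?_
  · refine ContinuousOn.aestronglyMeasurable (continuousOn_const.div
      (continuousOn_const.sub (hcont.mono sdiff_subset)) ?_) hS
    rintro ζ ⟨hζ, hζI⟩ h
    have heq : lam = ζ := hmono.injOn hlam hζ (by linarith)
    exact hζI ⟨by linarith, by linarith⟩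
  · refine (ae_restrict_iff' hS).2 (Eventually.of_forall ?_)
    rintro ζ ⟨hζ, hζI⟩
    have hr := hnonneg ζ hζ
    rw [Real.norm_eq_abs, abs_div, div_eq_mul_one_div |c|, mul_assoc]
    refine mul_le_mul_of_nonneg_left ?_ (abs_nonneg c)
    rw [← div_eq_mul_one_div, le_div_iff₀ (by linarith), one_div_mul_eq_div]
    rcases lt_or_ge ζ (lam - ε) with h | h
    · have hra : Ψ ζ < Ψ (lam - ε) := hmono hζ (mem_Ioi.2 (by linarith)) h
      rw [abs_of_pos (by linarith)]
      refine le_trans ?_ (le_add_of_nonneg_right hB0)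
      rw [hA, div_le_div_iff₀ (by linarith) (by linarith)]
      nlinarith
    · have h' : lam + ε < ζ := not_le.1 fun h' => hζI ⟨h, h'⟩
      have hrb : Ψ (lam + ε) < Ψ ζ := hmono (mem_Ioi.2 (by linarith)) hζ h'
      rw [abs_of_neg (by linarith), neg_sub]
      refine le_trans ?_ (le_add_of_nonneg_left hA0)
      rw [hB, div_le_div_iff₀ (by linarith) (by linarith)]
      nlinarith

theorem KL_minus_Kxi_nonneg (Ψ Ψ' Ψ'' : ℝ → ℝ)
    (hmono : StrictMonoOn Ψ (Ioi 0))
    (hnonneg : ∀ ζ ∈ Ioi (0:ℝ), 0 ≤ Ψ ζ)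
    (hΨd1 : ∀ ζ ∈ Ioi (0:ℝ), HasDerivAt Ψ (Ψ' ζ) ζ)
    (hΨd2 : ∀ ζ ∈ Ioi (0:ℝ), HasDerivAt Ψ' (Ψ'' ζ) ζ)
    (hΨ''cont : ContinuousOn Ψ'' (Ioi 0))
    (hΨ'pos : ∀ ζ ∈ Ioi (0:ℝ), 0 < Ψ' ζ)
    (hint : IntegrableOn (fun ζ => 1 / (1 + Ψ ζ)) (Ioi 0))
    (lam ξ : ℝ) (hlam : 0 < lam) (hξ : 0 < ξ)
    (Kl Kx : ℝ)
    (hKl : Tendsto (fun ε : ℝ =>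
        -(Real.pi)⁻¹ * ∫ ζ in Ioi (0:ℝ) \ Icc (lam - ε) (lam + ε),
          Ψ' lam / (Ψ lam - Ψ ζ))
      (𝓝[>] 0) (𝓝 Kl))
    (hKx : Tendsto (fun ε : ℝ =>
        -(Real.pi)⁻¹ * ∫ ζ in Ioi (0:ℝ) \ Icc (lam - ε) (lam + ε),
          (ξ^2 / (ξ^2 + ζ^2)) * (Ψ' lam / (Ψ lam - Ψ ζ)))
      (𝓝[>] 0) (𝓝 Kx)) :
    0 ≤ Kl * (ξ^2 / (ξ^2 + lam^2)) - Kx := by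
  have hcont : ContinuousOn Ψ (Ioi 0) := fun ζ hζ => (hΨd1 ζ hζ).continuousAt.continuousWithinAt
  refine ge_of_tendsto ((hKl.mul_const (ξ^2 / (ξ^2 + lam^2))).sub hKx) ?_
  filter_upwards [Ioo_mem_nhdsGT hlam] with ε hε
  have hf := integrableOn_div_sub_diff_Icc hmono hnonneg hcont hint (Ψ' lam) hε.1 hε.2
  have hwc : Continuous fun ζ : ℝ => ξ^2 / (ξ^2 + ζ^2) :=
    continuous_const.div (by fun_prop) fun ζ => by positivity
  have hwf : IntegrableOn (fun ζ => (ξ^2 / (ξ^2 + ζ^2)) * (Ψ' lam / (Ψ lam - Ψ ζ)))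
      (Ioi 0 \ Icc (lam - ε) (lam + ε)) := by
    refine Integrable.bdd_mul (c := 1) hf hwc.aestronglyMeasurable
      (Eventually.of_forall fun ζ => ?_)
    rw [Real.norm_of_nonneg (by positivity)]
    exact div_le_one_of_le₀ (by nlinarith [sq_nonneg ζ]) (by positivity)
  have key : 0 ≤ ∫ ζ in Ioi (0:ℝ) \ Icc (lam - ε) (lam + ε),
      ((ξ^2 / (ξ^2 + ζ^2)) * (Ψ' lam / (Ψ lam - Ψ ζ))
        - (ξ^2 / (ξ^2 + lam^2)) * (Ψ' lam / (Ψ lam - Ψ ζ))) := by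
    refine setIntegral_nonneg (measurableSet_Ioi.diff measurableSet_Icc) ?_
    rintro ζ ⟨hζ, -⟩
    have hζ0 : 0 < ζ := hζ
    have hd := (hΨ'pos lam hlam).le
    rw [← sub_mul]
    rcases le_total ζ lam with h | h
    · have hΨ := hmono.monotoneOn hζ hlam h
      refine mul_nonneg (sub_nonneg.2 ?_) (div_nonneg hd (by linarith))
      gcongr
    · have hΨ := hmono.monotoneOn hlam hζ h
      refine mul_nonneg_of_nonpos_of_nonpos (sub_nonpos.2 ?_)
        (div_nonpos_of_nonneg_of_nonpos hd (by linarith))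
      gcongr
  rw [integral_sub hwf (hf.const_mul _), integral_const_mul] at key
  have := mul_nonneg (inv_nonneg.2 Real.pi_pos.le) key
  linarith
end
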